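/- arXiv:math/0611083 — 4 statements merged into one kernel-verified Lean document; each statement's English description precedes it below -/
import Mathlib

section
/- There exist constants c₁, c₂ > 0 depending only on C, L and f (in particular independent of ε) such that for every ε ∈ (0,1] with L/(2πε) a positive integer and every classical solution u^ε of the rough problem, one has the zeroth-order error estimates ‖u^ε − u^{0,1}‖_{H¹(Ω^ε)} ≤ c₁ √ε and ‖u^ε − u^{0,1}‖_{L²(Ω⁰)} ≤ c₂ ε. -/
open MeasureTheory Real Set

noncomputable section

/-- Partial derivative in the first variable. -/
def pd1 (u : ℝ → ℝ → ℝ) (x y : ℝ) : ℝ := deriv (fun t => u t y) x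

/-- Partial derivative in the second variable. -/
def pd2 (u : ℝ → ℝ → ℝ) (x y : ℝ) : ℝ := deriv (fun t => u x t) y

/-- Laplacian. -/
def lap (u : ℝ → ℝ → ℝ) (x y : ℝ) : ℝ := pd1 (pd1 u) x y + pd2 (pd2 u) x y

/-- Squared modulus of the gradient. -/
def gradSq (u : ℝ → ℝ → ℝ) (x y : ℝ) : ℝ := (pd1 u x y) ^ 2 + (pd2 u x y) ^ 2

/-- The rough domain Ω^ε. -/
def OmegaEps (f : ℝ → ℝ) (L ε : ℝ) : Set (ℝ × ℝ) :=
  {p | 0 < p.1 ∧ p.1 < L ∧ ε * f (p.1 / ε) < p.2 ∧ p.2 < 1}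

/-- The smooth domain Ω⁰. -/
def Omega0 (L : ℝ) : Set (ℝ × ℝ) := Ioo 0 L ×ˢ Ioo (0 : ℝ) 1

/-- The periodic rough strip. -/
def RoughStrip (f : ℝ → ℝ) (ε : ℝ) : Set (ℝ × ℝ) :=
  {p | ε * f (p.1 / ε) < p.2 ∧ p.2 < 1}

/-- A classical solution of the rough problem `-Δu = C` in `Ω^ε`, `u = 0` on `Γ^ε ∪ Γ¹`,
periodic in `x₁`, with finite Dirichlet energy. -/
structure RoughSolution (f : ℝ → ℝ) (L C ε : ℝ) (u : ℝ → ℝ → ℝ) : Prop where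
  cont : ContinuousOn (fun p : ℝ × ℝ => u p.1 p.2) (closure (OmegaEps f L ε))
  periodic : ∀ x y, u (x + L) y = u x y
  smooth : ContDiffOn ℝ 2 (fun p : ℝ × ℝ => u p.1 p.2) (RoughStrip f ε)
  eqn : ∀ p ∈ OmegaEps f L ε, -(lap u p.1 p.2) = C
  bc_rough : ∀ x, u x (ε * f (x / ε)) = 0
  bc_top : ∀ x, u x 1 = 0
  energy : IntegrableOn (fun p : ℝ × ℝ => gradSq u p.1 p.2) (OmegaEps f L ε)

/-- The zeroth order approximation `u^{0,1}`: Poiseuille profile, linearly extended below. -/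
def u01 (C : ℝ) (x y : ℝ) : ℝ := if 0 ≤ y then C / 2 * (1 - y) * y else C / 2 * y

lemma ind_cont {S B : Set (ℝ × ℝ)} (hS : IsOpen S) {h : ℝ × ℝ → ℝ} (hh : ContinuousOn h S)
    (hz : ∀ p ∈ B, p ∉ S → ∀ᶠ q in nhdsWithin p B, q ∈ S → h q = 0) :
    ContinuousOn (S.indicator h) B := by
  intro p hp
  by_cases hpS : p ∈ S
  · have h1 : ContinuousAt h p := hh.continuousAt (hS.mem_nhds hpS)
    have h2 : S.indicator h =ᶠ[nhds p] h := by
      filter_upwards [hS.mem_nhds hpS] with q hq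
      simp [hq]
    exact (h1.congr h2.symm).continuousWithinAt
  · have h2 : S.indicator h =ᶠ[nhdsWithin p B] fun _ => 0 := by
      filter_upwards [hz p hp hpS] with q hq
      by_cases hqS : q ∈ S
      · simp [hqS, hq hqS]
      · simp [hqS]
    exact continuousWithinAt_const.congr_of_eventuallyEq h2 (by simp [hpS])

lemma ind_deriv {S B : Set (ℝ × ℝ)} (hS : IsOpen S) {h h' : ℝ × ℝ → ℝ}
    (hz : ∀ p ∈ B, p ∉ S → ∀ᶠ q in nhdsWithin p B, q ∈ S → h q = 0)
    {c : ℝ → ℝ × ℝ} (hc : Continuous c) {t : ℝ} (hB : ∀ᶠ s in nhds t, c s ∈ B)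
    (hd : c t ∈ S → HasDerivAt (fun s => h (c s)) (h' (c t)) t) :
    HasDerivAt (fun s => S.indicator h (c s)) (S.indicator h' (c t)) t := by
  by_cases hpS : c t ∈ S
  · have h2 : (fun s => S.indicator h (c s)) =ᶠ[nhds t] fun s => h (c s) := by
      filter_upwards [hc.continuousAt.preimage_mem_nhds (hS.mem_nhds hpS)] with q hq
      simp [show c q ∈ S from hq]
    rw [Set.indicator_of_mem hpS]
    exact (hd hpS).congr_of_eventuallyEq h2
  · have h3 : Filter.Tendsto c (nhds t) (nhdsWithin (c t) B) :=
      tendsto_nhdsWithin_iff.2 ⟨hc.continuousAt, hB⟩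
    have h2 : (fun s => S.indicator h (c s)) =ᶠ[nhds t] fun _ => 0 := by
      filter_upwards [h3.eventually (hz (c t) hB.self_of_nhds hpS)] with q hq
      by_cases hqS : c q ∈ S
      · simp [hqS, hq hqS]
      · simp [hqS]
    rw [Set.indicator_of_notMem hpS]
    exact (hasDerivAt_const t (0 : ℝ)).congr_of_eventuallyEq h2

lemma core {L : ℝ} (hL : 0 < L) {S : Set (ℝ × ℝ)} (hS : IsOpen S) {v v1 v2 v11 v22 : ℝ × ℝ → ℝ}
    (cv : ContinuousOn v S) (cv1 : ContinuousOn v1 S) (cv2 : ContinuousOn v2 S)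
    (cv11 : ContinuousOn v11 S) (cv22 : ContinuousOn v22 S)
    (d1 : ∀ p ∈ S, HasDerivAt (fun t => v (t, p.2)) (v1 p) p.1)
    (d2 : ∀ p ∈ S, HasDerivAt (fun t => v (p.1, t)) (v2 p) p.2)
    (d11 : ∀ p ∈ S, HasDerivAt (fun t => v1 (t, p.2)) (v11 p) p.1)
    (d22 : ∀ p ∈ S, HasDerivAt (fun t => v2 (p.1, t)) (v22 p) p.2)
    (pS : ∀ y, ((L, y) : ℝ × ℝ) ∈ S ↔ ((0, y) : ℝ × ℝ) ∈ S)
    (pv : ∀ y, v (L, y) = v (0, y)) (pv1 : ∀ y, v1 (L, y) = v1 (0, y))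
    (hbot : ∀ x, ((x, -2) : ℝ × ℝ) ∉ S) (htop : ∀ x, ((x, 2) : ℝ × ℝ) ∉ S)
    {η : ℝ} (hbd : ∀ p ∈ Icc 0 L ×ˢ Icc (-2 : ℝ) 2, p ∉ S →
      ∀ᶠ q in nhdsWithin p (Icc 0 L ×ˢ Icc (-2 : ℝ) 2), q ∈ S → v q ≤ η)
    {m k : ℝ → ℝ} (hm : ∀ s, HasDerivAt m (k s) s) (hk : Continuous k)
    (hm0 : ∀ s ≤ η, m s = 0) (hk0 : ∀ s ≤ η, k s = 0) :
    IntegrableOn (fun p => k (v p) * (v1 p ^ 2 + v2 p ^ 2) + m (v p) * (v11 p + v22 p))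
      ((Ioo 0 L ×ˢ Ioo (-2 : ℝ) 2) ∩ S) ∧
    ∫ p in (Ioo 0 L ×ˢ Ioo (-2 : ℝ) 2) ∩ S,
      (k (v p) * (v1 p ^ 2 + v2 p ^ 2) + m (v p) * (v11 p + v22 p)) = 0 := by
  set B := Icc 0 L ×ˢ Icc (-2 : ℝ) 2 with hBdef
  set O := Ioo 0 L ×ˢ Ioo (-2 : ℝ) 2 with hOdef
  have hOB : O ⊆ B := Set.prod_mono Ioo_subset_Icc_self Ioo_subset_Icc_self
  have hmc : Continuous m := continuous_iff_continuousAt.2 fun s => (hm s).continuousAt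
  have hBc : IsCompact B := isCompact_Icc.prod isCompact_Icc
  set Z1 : ℝ × ℝ → ℝ := fun p => m (v p) * v1 p with hZ1
  set Z2 : ℝ × ℝ → ℝ := fun p => m (v p) * v2 p with hZ2
  set G1 : ℝ × ℝ → ℝ := fun p => k (v p) * v1 p * v1 p + m (v p) * v11 p with hG1
  set G2 : ℝ × ℝ → ℝ := fun p => k (v p) * v2 p * v2 p + m (v p) * v22 p with hG2
  have zero : ∀ h : ℝ × ℝ → ℝ, (∀ q, v q ≤ η → h q = 0) → ∀ p ∈ B, p ∉ S →
      ∀ᶠ q in nhdsWithin p B, q ∈ S → h q = 0 := by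
    intro h hh p hp hpS
    filter_upwards [hbd p hp hpS] with q hq hqS using hh q (hq hqS)
  have zZ1 := zero Z1 (fun q hq => by simp [hZ1, hm0 _ hq])
  have zZ2 := zero Z2 (fun q hq => by simp [hZ2, hm0 _ hq])
  have zG1 := zero G1 (fun q hq => by simp [hG1, hm0 _ hq, hk0 _ hq])
  have zG2 := zero G2 (fun q hq => by simp [hG2, hm0 _ hq, hk0 _ hq])
  have kv : ContinuousOn (fun p => k (v p)) S := hk.comp_continuousOn cv
  have mv : ContinuousOn (fun p => m (v p)) S := hmc.comp_continuousOn cv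
  have cZ1 : ContinuousOn (S.indicator Z1) B := ind_cont hS (mv.mul cv1) zZ1
  have cZ2 : ContinuousOn (S.indicator Z2) B := ind_cont hS (mv.mul cv2) zZ2
  have cG1 : ContinuousOn (S.indicator G1) B :=
    ind_cont hS (((kv.mul cv1).mul cv1).add (mv.mul cv11)) zG1
  have cG2 : ContinuousOn (S.indicator G2) B :=
    ind_cont hS (((kv.mul cv2).mul cv2).add (mv.mul cv22)) zG2
  have iG1 : IntegrableOn (S.indicator G1) O := (cG1.integrableOn_compact hBc).mono_set hOB
  have iG2 : IntegrableOn (S.indicator G2) O := (cG2.integrableOn_compact hBc).mono_set hOB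
  have e1 : ∫ p in O, S.indicator G1 p = 0 := by
    have h1 : ∫ p in O, S.indicator G1 p
        = ∫ y in Ioo (-2 : ℝ) 2, ∫ x in Ioo 0 L, S.indicator G1 (x, y) := by
      rw [hOdef, Measure.volume_eq_prod, ← Measure.prod_restrict]
      apply integral_prod_symm
      rw [Measure.prod_restrict]
      exact iG1
    rw [h1]
    apply setIntegral_eq_zero_of_forall_eq_zero
    intro y hy
    have hcy : Continuous fun x : ℝ => ((x, y) : ℝ × ℝ) := by fun_prop
    have hmaps : MapsTo (fun x : ℝ => ((x, y) : ℝ × ℝ)) (Icc 0 L) B :=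
      fun x hx => ⟨hx, hy.1.le, hy.2.le⟩
    rw [← integral_Ioc_eq_integral_Ioo, ← intervalIntegral.integral_of_le hL.le,
      intervalIntegral.integral_eq_sub_of_hasDerivAt_of_le hL.le
        (f := fun x => S.indicator Z1 (x, y))]
    · have := pS y
      by_cases h0 : ((0, y) : ℝ × ℝ) ∈ S
      · have hLS := this.2 h0
        simp [h0, hLS, hZ1, pv, pv1]
      · have hLS : ((L, y) : ℝ × ℝ) ∉ S := fun h => h0 (this.1 h)
        simp [h0, hLS]
    · exact cZ1.comp hcy.continuousOn hmaps
    · intro x hx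
      apply ind_deriv hS zZ1 hcy
      · filter_upwards [Ioo_mem_nhds hx.1 hx.2] with s hs
        exact hmaps ⟨hs.1.le, hs.2.le⟩
      · intro hp
        exact ((hm _).comp x (d1 _ hp)).mul (d11 _ hp)
    · apply ContinuousOn.intervalIntegrable
      rw [uIcc_of_le hL.le]
      exact cG1.comp hcy.continuousOn hmaps
  have e2 : ∫ p in O, S.indicator G2 p = 0 := by
    have h1 : ∫ p in O, S.indicator G2 p
        = ∫ x in Ioo 0 L, ∫ y in Ioo (-2 : ℝ) 2, S.indicator G2 (x, y) := by
      rw [hOdef, Measure.volume_eq_prod, ← Measure.prod_restrict]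
      apply integral_prod
      rw [Measure.prod_restrict]
      exact iG2
    rw [h1]
    apply setIntegral_eq_zero_of_forall_eq_zero
    intro x hx
    have hcy : Continuous fun y : ℝ => ((x, y) : ℝ × ℝ) := by fun_prop
    have hmaps : MapsTo (fun y : ℝ => ((x, y) : ℝ × ℝ)) (Icc (-2) 2) B :=
      fun y hy => ⟨⟨hx.1.le, hx.2.le⟩, hy⟩
    have h22 : (-2 : ℝ) ≤ 2 := by norm_num
    rw [← integral_Ioc_eq_integral_Ioo, ← intervalIntegral.integral_of_le h22,
      intervalIntegral.integral_eq_sub_of_hasDerivAt_of_le h22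
        (f := fun y => S.indicator Z2 (x, y))]
    · simp [hbot, htop]
    · exact cZ2.comp hcy.continuousOn hmaps
    · intro y hy
      apply ind_deriv hS zZ2 hcy
      · filter_upwards [Ioo_mem_nhds hy.1 hy.2] with s hs
        exact hmaps ⟨hs.1.le, hs.2.le⟩
      · intro hp
        exact ((hm _).comp y (d2 _ hp)).mul (d22 _ hp)
    · apply ContinuousOn.intervalIntegrable
      rw [uIcc_of_le h22]
      exact cG2.comp hcy.continuousOn hmaps
  have hG : (fun p => k (v p) * (v1 p ^ 2 + v2 p ^ 2) + m (v p) * (v11 p + v22 p))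
      = fun p => G1 p + G2 p := by
    funext p; simp only [hG1, hG2]; ring
  have j1 : IntegrableOn G1 (O ∩ S) := by
    have := (integrable_indicator_iff hS.measurableSet).1 iG1
    rwa [IntegrableOn, Measure.restrict_restrict hS.measurableSet, inter_comm] at this
  have j2 : IntegrableOn G2 (O ∩ S) := by
    have := (integrable_indicator_iff hS.measurableSet).1 iG2
    rwa [IntegrableOn, Measure.restrict_restrict hS.measurableSet, inter_comm] at this
  rw [setIntegral_indicator hS.measurableSet] at e1 e2
  rw [hG]
  refine ⟨j1.add j2, ?_⟩
  rw [integral_add j1 j2, e1, e2, add_zero]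

/-- the truncation -/
def kf (η s : ℝ) : ℝ := max 0 (min 1 ((s - η) / η))
def mf (η s : ℝ) : ℝ := ∫ t in (0 : ℝ)..s, kf η t

lemma kf_cont (η : ℝ) : Continuous (kf η) := by unfold kf; fun_prop
lemma kf_nonneg (η s : ℝ) : 0 ≤ kf η s := le_max_left _ _
lemma kf_le (η s : ℝ) : kf η s ≤ 1 := max_le zero_le_one (min_le_left _ _)
lemma kf_zero {η s : ℝ} (hη : 0 < η) (h : s ≤ η) : kf η s = 0 := by
  unfold kf
  apply max_eq_left
  exact (min_le_right _ _).trans (div_nonpos_of_nonpos_of_nonneg (by linarith) hη.le)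
lemma kf_pos {η s : ℝ} (hη : 0 < η) (h : η < s) : 0 < kf η s := by
  unfold kf
  apply lt_max_of_lt_right
  apply lt_min one_pos
  apply div_pos (by linarith) hη
lemma kf_one {η s : ℝ} (hη : 0 < η) (h : 2 * η ≤ s) : kf η s = 1 := by
  unfold kf
  have : 1 ≤ (s - η) / η := by rw [le_div_iff₀ hη]; linarith
  rw [min_eq_left this]; simp
lemma mf_deriv (η s : ℝ) : HasDerivAt (mf η) (kf η s) s :=
  intervalIntegral.integral_hasDerivAt_right ((kf_cont η).intervalIntegrable _ _)
    ((kf_cont η).stronglyMeasurableAtFilter _ _) (kf_cont η).continuousAt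
lemma mf_zero {η s : ℝ} (hη : 0 < η) (h : s ≤ η) : mf η s = 0 := by
  unfold mf
  rw [intervalIntegral.integral_congr (g := fun _ => (0 : ℝ))]
  · simp
  · intro t ht
    apply kf_zero hη
    have := ht.2
    exact this.trans (sup_le hη.le h)
lemma mf_nonneg {η s : ℝ} (hη : 0 < η) : 0 ≤ mf η s := by
  rcases le_total s η with h | h
  · exact (mf_zero hη h).ge
  · exact intervalIntegral.integral_nonneg (hη.le.trans h) fun t _ => kf_nonneg _ _
lemma mf_le {η s : ℝ} (hη : 0 < η) (hs : 0 ≤ s) : mf η s ≤ s := by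
  unfold mf
  calc _ ≤ ∫ t in (0 : ℝ)..s, (1 : ℝ) := by
        apply intervalIntegral.integral_mono_on hs ((kf_cont η).intervalIntegrable _ _)
        · simp
        · intro t _; exact kf_le _ _
    _ = s := by simp
lemma mf_pos {η s : ℝ} (hη : 0 < η) (h : η < s) : 0 < mf η s := by
  have h1 : mf η s = mf η η + ∫ t in η..s, kf η t := by
    unfold mf
    rw [intervalIntegral.integral_add_adjacent_intervals] <;>
      exact (kf_cont η).intervalIntegrable _ _
  rw [h1, mf_zero hη le_rfl, zero_add]
  apply intervalIntegral.intervalIntegral_pos_of_pos_on ((kf_cont η).intervalIntegrable _ _) _ h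
  intro t ht
  exact kf_pos hη ht.1

lemma pd1_reg {S : Set (ℝ × ℝ)} (hS : IsOpen S) {n : ℕ} {u : ℝ → ℝ → ℝ}
    (h : ContDiffOn ℝ (n + 1) (fun p : ℝ × ℝ => u p.1 p.2) S) :
    ContDiffOn ℝ n (fun p : ℝ × ℝ => pd1 u p.1 p.2) S ∧
    ∀ p ∈ S, HasDerivAt (fun t => u t p.2) (pd1 u p.1 p.2) p.1 := by
  have key : ∀ p ∈ S, HasDerivAt (fun t => u t p.2)
      (fderiv ℝ (fun p : ℝ × ℝ => u p.1 p.2) p (1, 0)) p.1 := by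
    intro p hp
    have h1 : DifferentiableAt ℝ (fun p : ℝ × ℝ => u p.1 p.2) p :=
      (h.differentiableOn (by simp)).differentiableAt (hS.mem_nhds hp)
    have h2 : HasDerivAt (fun t : ℝ => ((t, p.2) : ℝ × ℝ)) (1, 0) p.1 :=
      (hasDerivAt_id p.1).prodMk (hasDerivAt_const _ _)
    exact HasFDerivAt.comp_hasDerivAt (x := p.1) (f := fun t : ℝ => ((t, p.2) : ℝ × ℝ))
      h1.hasFDerivAt h2
  refine ⟨?_, fun p hp => (key p hp).differentiableAt.hasDerivAt⟩
  have h3 : ContDiffOn ℝ n (fun p => fderiv ℝ (fun p : ℝ × ℝ => u p.1 p.2) p (1, 0)) S :=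
    (h.fderiv_of_isOpen hS le_rfl).clm_apply contDiffOn_const
  exact h3.congr fun p hp => (key p hp).deriv

lemma pd2_reg {S : Set (ℝ × ℝ)} (hS : IsOpen S) {n : ℕ} {u : ℝ → ℝ → ℝ}
    (h : ContDiffOn ℝ (n + 1) (fun p : ℝ × ℝ => u p.1 p.2) S) :
    ContDiffOn ℝ n (fun p : ℝ × ℝ => pd2 u p.1 p.2) S ∧
    ∀ p ∈ S, HasDerivAt (fun t => u p.1 t) (pd2 u p.1 p.2) p.2 := by
  have key : ∀ p ∈ S, HasDerivAt (fun t => u p.1 t)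
      (fderiv ℝ (fun p : ℝ × ℝ => u p.1 p.2) p (0, 1)) p.2 := by
    intro p hp
    have h1 : DifferentiableAt ℝ (fun p : ℝ × ℝ => u p.1 p.2) p :=
      (h.differentiableOn (by simp)).differentiableAt (hS.mem_nhds hp)
    have h2 : HasDerivAt (fun t : ℝ => ((p.1, t) : ℝ × ℝ)) (0, 1) p.2 :=
      (hasDerivAt_const _ _).prodMk (hasDerivAt_id p.2)
    exact HasFDerivAt.comp_hasDerivAt (x := p.2) (f := fun t : ℝ => ((p.1, t) : ℝ × ℝ))
      h1.hasFDerivAt h2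
  refine ⟨?_, fun p hp => (key p hp).differentiableAt.hasDerivAt⟩
  have h3 : ContDiffOn ℝ n (fun p => fderiv ℝ (fun p : ℝ × ℝ => u p.1 p.2) p (0, 1)) S :=
    (h.fderiv_of_isOpen hS le_rfl).clm_apply contDiffOn_const
  exact h3.congr fun p hp => (key p hp).deriv

/-- Geometric hypotheses on the rough boundary. -/
structure Geo (f : ℝ → ℝ) (L C ε : ℝ) : Prop where
  cf : Continuous f
  fb : ∀ t, -1 ≤ f t ∧ f t < 0
  L0 : 0 < L
  C0 : 0 < C
  e0 : 0 < ε
  e1 : ε ≤ 1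
  pf : ∀ x, f ((x + L) / ε) = f (x / ε)

section
variable {f : ℝ → ℝ} {L C ε : ℝ} {u : ℝ → ℝ → ℝ}

lemma Geo.gc (g : Geo f L C ε) : Continuous fun x => ε * f (x / ε) := by
  have := g.cf
  fun_prop
lemma Geo.glt (g : Geo f L C ε) (x : ℝ) : ε * f (x / ε) < 0 :=
  mul_neg_of_pos_of_neg g.e0 (g.fb _).2
lemma Geo.gge (g : Geo f L C ε) (x : ℝ) : -ε ≤ ε * f (x / ε) := by
  nlinarith [g.e0, (g.fb (x / ε)).1]

lemma Geo.openS (g : Geo f L C ε) : IsOpen (RoughStrip f ε) :=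
  (isOpen_lt (g.gc.comp continuous_fst) continuous_snd).inter
    (isOpen_lt continuous_snd continuous_const)

lemma Geo.omega_eq (g : Geo f L C ε) :
    OmegaEps f L ε = (Ioo 0 L ×ˢ Ioo (-2 : ℝ) 2) ∩ RoughStrip f ε := by
  ext p
  have h1 := g.gge p.1
  have h2 := g.e1
  simp only [OmegaEps, RoughStrip, mem_setOf_eq, mem_inter_iff, mem_prod, mem_Ioo]
  constructor
  · rintro ⟨a, b, c, d⟩
    exact ⟨⟨⟨a, b⟩, by linarith, by linarith⟩, c, d⟩
  · rintro ⟨⟨⟨a, b⟩, _, _⟩, c, d⟩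
    exact ⟨a, b, c, d⟩

lemma Geo.openOm (g : Geo f L C ε) : IsOpen (OmegaEps f L ε) := by
  rw [g.omega_eq]
  exact (isOpen_Ioo.prod isOpen_Ioo).inter g.openS

lemma Geo.closure_mem (g : Geo f L C ε) {x y : ℝ} (hx : x ∈ Icc 0 L)
    (hy : ε * f (x / ε) ≤ y) (hy1 : y ≤ 1) : ((x, y) : ℝ × ℝ) ∈ closure (OmegaEps f L ε) := by
  have hL := g.L0
  have step1 : ∀ x ∈ Ioo 0 L, ∀ y, ε * f (x / ε) ≤ y → y ≤ 1 →
      ((x, y) : ℝ × ℝ) ∈ closure (OmegaEps f L ε) := by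
    intro x hx y hy hy1
    have ht : Filter.Tendsto (fun t : ℝ => ((x, (1 - t) * y) : ℝ × ℝ)) (nhdsWithin 0 (Ioi 0))
        (nhds (x, y)) := by
      have : Continuous (fun t : ℝ => ((x, (1 - t) * y) : ℝ × ℝ)) := by fun_prop
      have h := this.tendsto 0
      simp only [sub_zero, one_mul] at h
      exact h.mono_left nhdsWithin_le_nhds
    apply mem_closure_of_tendsto ht
    filter_upwards [Ioo_mem_nhdsGT (zero_lt_one' ℝ)] with t ht
    have h0 := g.glt x
    refine ⟨hx.1, hx.2, ?_, ?_⟩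
    · show ε * f (x / ε) < (1 - t) * y
      nlinarith [mul_nonneg (by linarith [ht.2] : 0 ≤ 1 - t) (sub_nonneg.2 hy),
        mul_pos ht.1 (neg_pos.2 h0)]
    · show (1 - t) * y < 1
      nlinarith [mul_nonneg (by linarith [ht.2] : 0 ≤ 1 - t) (sub_nonneg.2 hy1), ht.1]
  rw [← closure_closure]
  have hc : Continuous (fun t : ℝ => (((1 - t) * x + t * (L / 2),
      max y (ε * f (((1 - t) * x + t * (L / 2)) / ε))) : ℝ × ℝ)) := by
    have := g.gc
    have h2 : Continuous fun t : ℝ => (1 - t) * x + t * (L / 2) := by fun_prop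
    exact h2.prodMk (continuous_const.max (this.comp h2))
  have ht := hc.tendsto 0
  simp only [sub_zero, one_mul, zero_mul, add_zero, max_eq_left hy] at ht
  apply mem_closure_of_tendsto (ht.mono_left (nhdsWithin_le_nhds (s := Ioi 0)))
  filter_upwards [Ioo_mem_nhdsGT (zero_lt_one' ℝ)] with t ht
  apply step1
  · constructor
    · nlinarith [mul_pos ht.1 hL, mul_nonneg (by linarith [ht.2] : 0 ≤ 1 - t) hx.1]
    · nlinarith [mul_pos ht.1 hL, mul_nonneg (by linarith [ht.2] : 0 ≤ 1 - t)
        (sub_nonneg.2 hx.2)]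
  · exact le_max_right _ _
  · exact max_le hy1 (by linarith [g.glt ((1 - t) * x + t * (L / 2))])

/-- Core identity for `a u + α + β y + κ y²`. -/
lemma Geo.ident (g : Geo f L C ε) (hu : RoughSolution f L C ε u) (a α β κ : ℝ)
    (hb : ∀ x, α + β * (ε * f (x / ε)) + κ * (ε * f (x / ε)) ^ 2 ≤ 0)
    (ht : α + β + κ ≤ 0) {η : ℝ} (hη : 0 < η) :
    IntegrableOn (fun p : ℝ × ℝ =>
      kf η (a * u p.1 p.2 + (α + β * p.2 + κ * p.2 ^ 2)) *
        ((a * pd1 u p.1 p.2) ^ 2 + (a * pd2 u p.1 p.2 + (β + 2 * κ * p.2)) ^ 2)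
      + mf η (a * u p.1 p.2 + (α + β * p.2 + κ * p.2 ^ 2)) * (-a * C + 2 * κ)) (OmegaEps f L ε) ∧
    ∫ p in OmegaEps f L ε,
      (kf η (a * u p.1 p.2 + (α + β * p.2 + κ * p.2 ^ 2)) *
        ((a * pd1 u p.1 p.2) ^ 2 + (a * pd2 u p.1 p.2 + (β + 2 * κ * p.2)) ^ 2)
      + mf η (a * u p.1 p.2 + (α + β * p.2 + κ * p.2 ^ 2)) * (-a * C + 2 * κ)) = 0 := by
  have hS := g.openS
  obtain ⟨c1, d1⟩ := pd1_reg (n := 1) hS (by simpa [one_add_one_eq_two] using hu.smooth)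
  obtain ⟨c2, d2⟩ := pd2_reg (n := 1) hS (by simpa [one_add_one_eq_two] using hu.smooth)
  obtain ⟨c11, d11⟩ := pd1_reg (n := 0) hS (u := pd1 u) (by simpa using c1)
  obtain ⟨c22, d22⟩ := pd2_reg (n := 0) hS (u := pd2 u) (by simpa using c2)
  have cu := hu.smooth.continuousOn
  have pdp : ∀ x y, pd1 u (x + L) y = pd1 u x y := by
    intro x y
    have h1 : (fun t => u t y) = fun t => u (t + L) y := by
      funext t; exact (hu.periodic t y).symm
    unfold pd1
    conv_rhs => rw [h1]
    rw [deriv_comp_add_const (f := fun t => u t y)]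
  have key := core g.L0 hS (η := η)
    (v := fun p => a * u p.1 p.2 + (α + β * p.2 + κ * p.2 ^ 2))
    (v1 := fun p => a * pd1 u p.1 p.2)
    (v2 := fun p => a * pd2 u p.1 p.2 + (β + 2 * κ * p.2))
    (v11 := fun p => a * pd1 (pd1 u) p.1 p.2)
    (v22 := fun p => a * pd2 (pd2 u) p.1 p.2 + 2 * κ)
    (by fun_prop)
    (continuousOn_const.mul c1.continuousOn)
    ((continuousOn_const.mul c2.continuousOn).add (by fun_prop))
    (continuousOn_const.mul c11.continuousOn)
    ((continuousOn_const.mul c22.continuousOn).add (by fun_prop))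
    (fun p hp => ((d1 p hp).const_mul a).add_const (α + β * p.2 + κ * p.2 ^ 2))
    (fun p hp => by
      refine ((d2 p hp).const_mul a).add ?_
      have h1 := (((hasDerivAt_id' p.2).const_mul β).const_add α).add
        (((hasDerivAt_id' p.2).pow 2).const_mul κ)
      exact h1.congr_deriv (by norm_num; ring))
    (fun p hp => (d11 p hp).const_mul a)
    (fun p hp => by
      refine ((d22 p hp).const_mul a).add ?_
      have h1 := ((hasDerivAt_id' p.2).const_mul (2 * κ)).const_add β
      simpa using h1)
    (fun y => by
      have := g.pf 0
      simp only [zero_add] at this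
      simp only [RoughStrip, mem_setOf_eq, this])
    (fun y => by
      have := hu.periodic 0 y
      simp only [zero_add] at this
      simp only [this])
    (fun y => by
      have := pdp 0 y
      simp only [zero_add] at this
      simp only [this])
    (fun x h => by
      have := h.1
      have h2 := g.gge x
      have := g.e1
      simp only at *
      linarith)
    (fun x h => by
      have := h.2
      simp only at this
      linarith)
    (by
      rintro ⟨x, y⟩ ⟨hx, hy⟩ hp
      simp only at hx hy
      by_cases hin : ε * f (x / ε) ≤ y ∧ y ≤ 1
      · have hcl := g.closure_mem hx hin.1 hin.2
        have hcw := hu.cont _ hcl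
        have hcw2 : ContinuousWithinAt (fun p : ℝ × ℝ => a * u p.1 p.2 +
            (α + β * p.2 + κ * p.2 ^ 2)) (closure (OmegaEps f L ε)) (x, y) :=
          (continuousWithinAt_const.mul hcw).add (by fun_prop)
        have hval : a * u x y + (α + β * y + κ * y ^ 2) ≤ 0 := by
          rcases eq_or_lt_of_le hin.1 with h | h
          · rw [← h, hu.bc_rough]
            have := hb x
            linarith
          · rcases eq_or_lt_of_le hin.2 with h' | h'
            · rw [h', hu.bc_top]
              linarith
            · exact absurd ⟨h, h'⟩ hp
        have hev := hcw2.eventually (gt_mem_nhds (lt_of_le_of_lt hval hη))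
        rw [eventually_nhdsWithin_iff] at hev ⊢
        filter_upwards [hev] with q hq hqB hqS
        exact (hq (g.closure_mem hqB.1 hqS.1.le hqS.2.le)).le
      · apply Filter.Eventually.filter_mono nhdsWithin_le_nhds
        rw [not_and_or, not_le, not_le] at hin
        rcases hin with h | h
        · have : ∀ᶠ q : ℝ × ℝ in nhds (x, y), q.2 < ε * f (q.1 / ε) :=
            (isOpen_lt continuous_snd (g.gc.comp continuous_fst)).mem_nhds h
          filter_upwards [this] with q hq hqS
          exact absurd hqS.1 (not_lt.2 hq.le)
        · have : ∀ᶠ q : ℝ × ℝ in nhds (x, y), 1 < q.2 :=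
            (isOpen_lt continuous_const continuous_snd).mem_nhds h
          filter_upwards [this] with q hq hqS
          exact absurd hqS.2 (not_lt.2 hq.le))
    (mf_deriv η) (kf_cont η) (fun s hs => mf_zero hη hs) (fun s hs => kf_zero hη hs)
  rw [← g.omega_eq] at key
  have hcongr : ∀ p ∈ OmegaEps f L ε,
      a * pd1 (pd1 u) p.1 p.2 + (a * pd2 (pd2 u) p.1 p.2 + 2 * κ) = -a * C + 2 * κ := by
    intro p hp
    have := hu.eqn p hp
    unfold lap at this
    rw [← this]; ring
  constructor
  · refine key.1.congr_fun (fun p hp => ?_) g.openOm.measurableSet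
    simp only [hcongr p hp]
  · rw [← key.2]
    refine setIntegral_congr_fun g.openOm.measurableSet (fun p hp => ?_)
    simp only [hcongr p hp]

lemma Geo.maxp (g : Geo f L C ε) (hu : RoughSolution f L C ε u) (a α β κ : ℝ)
    (hb : ∀ x, α + β * (ε * f (x / ε)) + κ * (ε * f (x / ε)) ^ 2 ≤ 0)
    (ht : α + β + κ ≤ 0) (hpos : 0 < -a * C + 2 * κ) :
    ∀ p ∈ OmegaEps f L ε, a * u p.1 p.2 + (α + β * p.2 + κ * p.2 ^ 2) ≤ 0 := by
  intro p hp
  apply le_of_forall_pos_le_add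
  intro η hη
  rw [zero_add]
  obtain ⟨hi, h0⟩ := g.ident hu a α β κ hb ht hη
  by_contra hcon
  rw [not_le] at hcon
  have hOm := g.openOm
  have hS := g.openS
  obtain ⟨c1, _⟩ := pd1_reg (n := 1) hS (by simpa [one_add_one_eq_two] using hu.smooth)
  obtain ⟨c2, _⟩ := pd2_reg (n := 1) hS (by simpa [one_add_one_eq_two] using hu.smooth)
  have hsub : OmegaEps f L ε ⊆ RoughStrip f ε := by
    rw [g.omega_eq]; exact inter_subset_right
  have cu := hu.smooth.continuousOn
  have cv : ContinuousOn (fun p : ℝ × ℝ => a * u p.1 p.2 + (α + β * p.2 + κ * p.2 ^ 2))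
    (RoughStrip f ε) := by fun_prop
  have mc : Continuous (mf η) := continuous_iff_continuousAt.2 fun s => (mf_deriv η s).continuousAt
  have cG : ContinuousOn (fun p : ℝ × ℝ =>
      kf η (a * u p.1 p.2 + (α + β * p.2 + κ * p.2 ^ 2)) *
        ((a * pd1 u p.1 p.2) ^ 2 + (a * pd2 u p.1 p.2 + (β + 2 * κ * p.2)) ^ 2)
      + mf η (a * u p.1 p.2 + (α + β * p.2 + κ * p.2 ^ 2)) * (-a * C + 2 * κ))
      (OmegaEps f L ε) := by
    apply ContinuousOn.mono _ hsub
    have h1 := c1.continuousOn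
    have h2 := c2.continuousOn
    exact (((kf_cont η).comp_continuousOn cv).mul
      (((continuousOn_const.mul h1).pow 2).add
        (((continuousOn_const.mul h2).add (by fun_prop)).pow 2))).add
      ((mc.comp_continuousOn cv).mul continuousOn_const)
  rw [setIntegral_eq_zero_iff_of_nonneg_ae _ hi] at h0
  · have := Measure.eqOn_open_of_ae_eq h0 hOm cG continuousOn_const hp
    simp only [Pi.zero_apply] at this
    have h3 := mul_pos (mf_pos hη hcon) hpos
    have h4 := mul_nonneg (kf_nonneg η (a * u p.1 p.2 + (α + β * p.2 + κ * p.2 ^ 2)))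
      (add_nonneg (sq_nonneg (a * pd1 u p.1 p.2))
        (sq_nonneg (a * pd2 u p.1 p.2 + (β + 2 * κ * p.2))))
    linarith
  · apply Filter.Eventually.of_forall
    intro q
    have h3 := mul_nonneg (mf_nonneg hη (s := a * u q.1 q.2 + (α + β * q.2 + κ * q.2 ^ 2))) hpos.le
    have h4 := mul_nonneg (kf_nonneg η (a * u q.1 q.2 + (α + β * q.2 + κ * q.2 ^ 2)))
      (add_nonneg (sq_nonneg (a * pd1 u q.1 q.2))
        (sq_nonneg (a * pd2 u q.1 q.2 + (β + 2 * κ * q.2))))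
    simp only [Pi.zero_apply]
    linarith

lemma Geo.bounds (g : Geo f L C ε) (hu : RoughSolution f L C ε u) :
    ∀ p ∈ OmegaEps f L ε, 0 ≤ u p.1 p.2 ∧ C / 2 * (p.2 - p.2 ^ 2) ≤ u p.1 p.2 ∧
      u p.1 p.2 ≤ C / 2 * (p.2 - p.2 ^ 2) + C * ε := by
  intro p hp
  have hC := g.C0
  have he := g.e0
  have he1 := g.e1
  have hp1 : -1 ≤ p.2 := by linarith [hp.2.2.1, g.gge p.1]
  have hp2 : p.2 < 1 := hp.2.2.2
  have hsq : p.2 ^ 2 ≤ 1 := by nlinarith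
  refine ⟨?_, ?_, ?_⟩
  · have := g.maxp hu (-1) 0 0 0 (by simp) (by simp) (by simpa using hC) p hp
    linarith
  · apply le_of_forall_pos_le_add
    intro τ hτ
    have := g.maxp hu (-1) (-τ) (C / 2) (-C / 2 + τ)
      (fun x => by
        have h1 := g.gge x
        have h2 := g.glt x
        set s := ε * f (x / ε)
        have : s ^ 2 ≤ 1 := by nlinarith
        nlinarith [mul_pos hC (neg_pos.2 h2), mul_nonneg hC.le (sq_nonneg s)])
      (by linarith) (by linarith) p hp
    nlinarith [mul_nonneg hτ.le (sq_nonneg p.2)]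
  · apply le_of_forall_pos_le_add
    intro τ hτ
    have := g.maxp hu 1 (-τ - C * ε) (-C / 2) (C / 2 + τ)
      (fun x => by
        have h1 := g.gge x
        have h2 := g.glt x
        set s := ε * f (x / ε)
        have h3 : s ^ 2 ≤ ε := by nlinarith
        have h4 : s ^ 2 ≤ 1 := by nlinarith
        nlinarith [mul_nonneg hC.le (sub_nonneg.2 h3), mul_nonneg hτ.le (sub_nonneg.2 h4),
          mul_nonneg hC.le (by linarith : 0 ≤ ε + s)])
      (by nlinarith) (by linarith) p hp
    nlinarith [mul_nonneg hτ.le (sq_nonneg p.2)]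

lemma Geo.sub (g : Geo f L C ε) : OmegaEps f L ε ⊆ Ioo 0 L ×ˢ Ioo (-1 : ℝ) 1 := by
  intro p hp
  have := g.gge p.1
  have := g.e1
  exact ⟨⟨hp.1, hp.2.1⟩, by linarith [hp.2.2.1], hp.2.2.2⟩

lemma Geo.vol (g : Geo f L C ε) : volume (OmegaEps f L ε) ≤ ENNReal.ofReal (2 * L) := by
  refine (measure_mono g.sub).trans ?_
  rw [Measure.volume_eq_prod, Measure.prod_prod, Real.volume_Ioo, Real.volume_Ioo,
    ← ENNReal.ofReal_mul (by linarith [g.L0])]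
  apply ENNReal.ofReal_le_ofReal
  linarith

lemma Geo.intBdd (g : Geo f L C ε) {h : ℝ × ℝ → ℝ} (hc : ContinuousOn h (OmegaEps f L ε)) (M : ℝ)
    (hM : ∀ p ∈ OmegaEps f L ε, |h p| ≤ M) : IntegrableOn h (OmegaEps f L ε) := by
  apply IntegrableOn.of_bound (g.vol.trans_lt ENNReal.ofReal_lt_top)
    (hc.aestronglyMeasurable g.openOm.measurableSet) M
  exact (ae_restrict_iff' g.openOm.measurableSet).2 (Filter.Eventually.of_forall hM)

lemma Geo.Ubd (g : Geo f L C ε) : ∀ p ∈ OmegaEps f L ε, |C / 2 * (p.2 - p.2 ^ 2)| ≤ C := by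
  intro p hp
  have hC := g.C0
  have := (g.sub hp).2
  have h1 := this.1
  have h2 := this.2
  have h3 : p.2 ^ 2 ≤ 1 := by nlinarith
  rw [abs_le]
  constructor <;> nlinarith [sq_nonneg p.2]

lemma Geo.intU (g : Geo f L C ε) :
    IntegrableOn (fun p : ℝ × ℝ => C / 2 * (p.2 - p.2 ^ 2)) (OmegaEps f L ε) :=
  g.intBdd (by fun_prop) C g.Ubd

lemma Geo.subS (g : Geo f L C ε) : OmegaEps f L ε ⊆ RoughStrip f ε := by
  rw [g.omega_eq]; exact inter_subset_right

lemma Geo.intu (g : Geo f L C ε) (hu : RoughSolution f L C ε u) :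
    IntegrableOn (fun p : ℝ × ℝ => u p.1 p.2) (OmegaEps f L ε) := by
  refine g.intBdd (hu.smooth.continuousOn.mono g.subS) (C + C * ε) fun p hp => ?_
  have h1 := g.bounds hu p hp
  have h2 := abs_le.1 (g.Ubd p hp)
  rw [abs_of_nonneg h1.1]
  linarith [h1.2.2]

lemma Geo.energyLe (g : Geo f L C ε) (hu : RoughSolution f L C ε u) :
    ∫ p in OmegaEps f L ε, gradSq u p.1 p.2 ≤ C * ∫ p in OmegaEps f L ε, u p.1 p.2 := by
  have hOm := g.openOm
  have cu : ContinuousOn (fun p : ℝ × ℝ => u p.1 p.2) (OmegaEps f L ε) :=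
    hu.smooth.continuousOn.mono g.subS
  have hη : ∀ n : ℕ, 0 < 1 / ((n : ℝ) + 1) := fun n => by positivity
  have gn : ∀ p : ℝ × ℝ, 0 ≤ gradSq u p.1 p.2 := fun p => by unfold gradSq; positivity
  have km : ∀ n : ℕ, AEStronglyMeasurable
      (fun p : ℝ × ℝ => kf (1 / ((n : ℝ) + 1)) (u p.1 p.2) * gradSq u p.1 p.2)
      (volume.restrict (OmegaEps f L ε)) := fun n =>
    (((kf_cont _).comp_continuousOn cu).aestronglyMeasurable hOm.measurableSet).mul
      hu.energy.aestronglyMeasurable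
  have hlim : Filter.Tendsto (fun n : ℕ => ∫ p in OmegaEps f L ε,
      kf (1 / ((n : ℝ) + 1)) (u p.1 p.2) * gradSq u p.1 p.2) Filter.atTop
      (nhds (∫ p in OmegaEps f L ε, gradSq u p.1 p.2)) := by
    apply tendsto_integral_of_dominated_convergence _ km hu.energy
    · intro n
      apply Filter.Eventually.of_forall
      intro p
      rw [Real.norm_eq_abs, abs_of_nonneg (mul_nonneg (kf_nonneg _ _) (gn p))]
      exact mul_le_of_le_one_left (gn p) (kf_le _ _)
    · refine (ae_restrict_iff' hOm.measurableSet).2 (Filter.Eventually.of_forall fun p hp => ?_)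
      rcases eq_or_lt_of_le (g.bounds hu p hp).1 with h | h
      · have hmin : ∀ᶠ q in nhds p, 0 ≤ u q.1 q.2 := by
          filter_upwards [hOm.mem_nhds hp] with q hq using (g.bounds hu q hq).1
        have c1 : ContinuousAt (fun t : ℝ => ((t, p.2) : ℝ × ℝ)) p.1 := by fun_prop
        have c2 : ContinuousAt (fun t : ℝ => ((p.1, t) : ℝ × ℝ)) p.2 := by fun_prop
        have e1 : pd1 u p.1 p.2 = 0 := by
          apply IsLocalMin.deriv_eq_zero
          filter_upwards [c1.eventually hmin] with t ht
          rw [← h]; exact ht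
        have e2 : pd2 u p.1 p.2 = 0 := by
          apply IsLocalMin.deriv_eq_zero
          filter_upwards [c2.eventually hmin] with t ht
          rw [← h]; exact ht
        simp [gradSq, e1, e2]
      · apply tendsto_const_nhds.congr'
        have h0 : Filter.Tendsto (fun n : ℕ => 2 * (1 / ((n : ℝ) + 1))) Filter.atTop
            (nhds (2 * 0)) := tendsto_one_div_add_atTop_nhds_zero_nat.const_mul 2
        rw [mul_zero] at h0
        filter_upwards [h0.eventually (gt_mem_nhds h)] with n hn
        rw [kf_one (hη n) hn.le, one_mul]
  refine le_of_tendsto hlim (Filter.Eventually.of_forall fun n => ?_)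
  obtain ⟨hi, h0⟩ := g.ident hu 1 0 0 0 (by simp) (by simp) (hη n)
  set η := 1 / ((n : ℝ) + 1)
  simp only [one_mul, zero_mul, mul_zero, add_zero] at h0
  have ik : IntegrableOn (fun p : ℝ × ℝ => kf η (u p.1 p.2) * gradSq u p.1 p.2)
      (OmegaEps f L ε) := by
    refine Integrable.mono' hu.energy (km n) (Filter.Eventually.of_forall fun p => ?_)
    rw [Real.norm_eq_abs, abs_of_nonneg (mul_nonneg (kf_nonneg _ _) (gn p))]
    exact mul_le_of_le_one_left (gn p) (kf_le _ _)
  have mc : Continuous (mf η) := continuous_iff_continuousAt.2 fun s => (mf_deriv η s).continuousAt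
  have im : IntegrableOn (fun p : ℝ × ℝ => mf η (u p.1 p.2)) (OmegaEps f L ε) := by
    refine Integrable.mono' (g.intu hu)
      ((mc.comp_continuousOn cu).aestronglyMeasurable hOm.measurableSet) ?_
    refine (ae_restrict_iff' hOm.measurableSet).2 (Filter.Eventually.of_forall fun p hp => ?_)
    rw [Real.norm_eq_abs, abs_of_nonneg (mf_nonneg (hη n))]
    exact mf_le (hη n) (g.bounds hu p hp).1
  have hsum : ∫ p in OmegaEps f L ε, (kf η (u p.1 p.2) * gradSq u p.1 p.2
      + mf η (u p.1 p.2) * (-1 * C)) = 0 := h0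
  rw [integral_add ik (im.mul_const _), integral_mul_const] at hsum
  have hle : ∫ p in OmegaEps f L ε, mf η (u p.1 p.2) ≤ ∫ p in OmegaEps f L ε, u p.1 p.2 :=
    setIntegral_mono_on im (g.intu hu) hOm.measurableSet
      fun p hp => mf_le (hη n) (g.bounds hu p hp).1
  nlinarith [mul_le_mul_of_nonneg_left hle g.C0.le]

lemma Geo.intpd2 (g : Geo f L C ε) (hu : RoughSolution f L C ε u) :
    IntegrableOn (fun p : ℝ × ℝ => pd2 u p.1 p.2) (OmegaEps f L ε) := by
  obtain ⟨c2, _⟩ := pd2_reg (n := 1) g.openS (by simpa [one_add_one_eq_two] using hu.smooth)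
  have i1 : IntegrableOn (fun _ : ℝ × ℝ => (1 : ℝ)) (OmegaEps f L ε) :=
    g.intBdd continuousOn_const 1 (by simp)
  refine Integrable.mono' (i1.add hu.energy)
    ((c2.continuousOn.mono g.subS).aestronglyMeasurable g.openOm.measurableSet)
    (Filter.Eventually.of_forall fun p => ?_)
  simp only [Pi.add_apply, gradSq, Real.norm_eq_abs]
  nlinarith [sq_nonneg (pd1 u p.1 p.2), sq_nonneg (|pd2 u p.1 p.2| - 1), sq_abs (pd2 u p.1 p.2),
    abs_nonneg (pd2 u p.1 p.2)]

lemma Geo.intUpd2 (g : Geo f L C ε) (hu : RoughSolution f L C ε u) :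
    IntegrableOn (fun p : ℝ × ℝ => C / 2 * (1 - 2 * p.2) * pd2 u p.1 p.2) (OmegaEps f L ε) := by
  refine Integrable.bdd_mul (c := 2 * C) (g.intpd2 hu) ?_ ?_
  · have : Continuous fun p : ℝ × ℝ => C / 2 * (1 - 2 * p.2) := by fun_prop
    exact this.aestronglyMeasurable
  · refine (ae_restrict_iff' g.openOm.measurableSet).2 (Filter.Eventually.of_forall fun p hp => ?_)
    have h := (g.sub hp).2
    have h1 := h.1
    have h2 := h.2
    have hC := g.C0
    rw [Real.norm_eq_abs, abs_le]
    constructor <;> nlinarith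

/-- the combined integrand -/
def Hf (C : ℝ) (u : ℝ → ℝ → ℝ) (p : ℝ × ℝ) : ℝ :=
  (C / 2 * (1 - 2 * p.2)) ^ 2 - 2 * (C / 2 * (1 - 2 * p.2) * pd2 u p.1 p.2)
    + 2 * C * u p.1 p.2 - C * (C / 2 * (p.2 - p.2 ^ 2))

lemma Geo.intU2 (g : Geo f L C ε) :
    IntegrableOn (fun p : ℝ × ℝ => (C / 2 * (1 - 2 * p.2)) ^ 2) (OmegaEps f L ε) := by
  refine g.intBdd (by fun_prop) ((2 * C) ^ 2) fun p hp => ?_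
  have h := (g.sub hp).2
  have h1 := h.1
  have h2 := h.2
  have hC := g.C0
  rw [abs_of_nonneg (sq_nonneg _)]
  apply sq_le_sq'
  · nlinarith
  · nlinarith

lemma Geo.intH (g : Geo f L C ε) (hu : RoughSolution f L C ε u) :
    IntegrableOn (Hf C u) (OmegaEps f L ε) :=
  ((g.intU2.sub ((g.intUpd2 hu).const_mul 2)).add ((g.intu hu).const_mul (2 * C))).sub
    (g.intU.const_mul C)

lemma Geo.intHle (g : Geo f L C ε) (hu : RoughSolution f L C ε u) :
    ∫ p in OmegaEps f L ε, Hf C u p ≤ 3 / 2 * C ^ 2 * ε * L := by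
  have hOm := g.openOm.measurableSet
  have hI := (integrable_indicator_iff hOm).2 (g.intH hu)
  rw [← integral_indicator hOm]
  rw [Measure.volume_eq_prod] at hI ⊢
  rw [integral_prod _ hI]
  have hslice := hI.prod_right_ae
  obtain ⟨_, d2⟩ := pd2_reg (n := 1) g.openS (by simpa [one_add_one_eq_two] using hu.smooth)
  have hind : ∀ x ∈ Ioo 0 L, (fun y => (OmegaEps f L ε).indicator (Hf C u) (x, y))
      = (Ioo (ε * f (x / ε)) 1).indicator fun y => Hf C u (x, y) := by
    intro x hx
    funext y
    by_cases hy : y ∈ Ioo (ε * f (x / ε)) 1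
    · rw [indicator_of_mem hy, indicator_of_mem (show (x, y) ∈ OmegaEps f L ε from
        ⟨hx.1, hx.2, hy.1, hy.2⟩)]
    · rw [indicator_of_notMem hy, indicator_of_notMem]
      exact fun h => hy ⟨h.2.2.1, h.2.2.2⟩
  have hpt : ∀ᵐ x : ℝ, (∫ y, (OmegaEps f L ε).indicator (Hf C u) (x, y))
      ≤ (Ioo 0 L).indicator (fun _ => 3 / 2 * C ^ 2 * ε) x := by
    filter_upwards [hslice] with x hx
    by_cases hxI : x ∈ Ioo 0 L
    · rw [hind x hxI] at hx ⊢
      rw [indicator_of_mem hxI, integral_indicator measurableSet_Ioo]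
      have hx' := (integrable_indicator_iff measurableSet_Ioo).1 hx
      have h0 := g.glt x
      have h1 := g.gge x
      have hle : ε * f (x / ε) ≤ 1 := by linarith
      rw [← integral_Ioc_eq_integral_Ioo, ← intervalIntegral.integral_of_le hle,
        intervalIntegral.integral_eq_sub_of_hasDerivAt_of_le hle
        (f := fun y => (C / 2 * (1 - 2 * y)) * (C / 2 * (y - y ^ 2) - 2 * u x y))]
      · simp only [hu.bc_top, hu.bc_rough]
        set s := ε * f (x / ε)
        have hC := g.C0
        have he := g.e0
        have he1 := g.e1
        have e : C / 2 * (1 - 2 * 1) * (C / 2 * (1 - 1 ^ 2) - 2 * 0)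
            - C / 2 * (1 - 2 * s) * (C / 2 * (s - s ^ 2) - 2 * 0)
            = C ^ 2 * ((1 - 2 * s) * (s ^ 2 - s) / 4) := by ring
        rw [e]
        have e3 : (1 - 2 * s) * (s ^ 2 - s) / 4 ≤ 3 / 2 * ε := by
          have a1 : 1 - 2 * s ≤ 3 := by linarith
          have a2 : s ^ 2 - s ≤ 2 * ε := by nlinarith
          have a3 : 0 ≤ s ^ 2 - s := by nlinarith
          nlinarith
        nlinarith [mul_le_mul_of_nonneg_left e3 (sq_nonneg C)]
      · have hcu : ContinuousOn (fun y => u x y) (Icc (ε * f (x / ε)) 1) :=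
          hu.cont.comp (f := fun y : ℝ => ((x, y) : ℝ × ℝ)) (by fun_prop)
            (fun y hy => g.closure_mem ⟨hxI.1.le, hxI.2.le⟩ hy.1 hy.2)
        fun_prop
      · intro y hy
        have hd := d2 (x, y) ⟨hy.1, hy.2⟩
        simp only at hd
        have hA : HasDerivAt (fun y : ℝ => C / 2 * (1 - 2 * y)) (C / 2 * (-2)) y := by
          have := (((hasDerivAt_id' y).const_mul 2).const_sub 1).const_mul (C / 2)
          simpa using this
        have hB : HasDerivAt (fun y : ℝ => C / 2 * (y - y ^ 2)) (C / 2 * (1 - 2 * y)) y := by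
          have := ((hasDerivAt_id' y).sub ((hasDerivAt_id' y).pow 2)).const_mul (C / 2)
          exact this.congr_deriv (by norm_num)
        exact (hA.mul (hB.sub (hd.const_mul 2))).congr_deriv (by simp only [Hf, Pi.sub_apply]; ring)
      · rw [intervalIntegrable_iff_integrableOn_Ioo_of_le hle]
        exact hx'
    · rw [indicator_of_notMem hxI]
      have : (fun y => (OmegaEps f L ε).indicator (Hf C u) (x, y)) = fun _ => 0 := by
        funext y
        rw [indicator_of_notMem]
        exact fun h => hxI ⟨h.1, h.2.1⟩
      rw [this]; simp
  have iR : Integrable ((Ioo 0 L).indicator fun _ : ℝ => 3 / 2 * C ^ 2 * ε) := by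
    rw [integrable_indicator_iff measurableSet_Ioo]
    exact integrableOn_const (by simp)
  refine (integral_mono_ae hI.integral_prod_left iR hpt).trans ?_
  rw [integral_indicator measurableSet_Ioo, setIntegral_const]
  simp only [Measure.real, Real.volume_Ioo, smul_eq_mul, sub_zero]
  rw [ENNReal.toReal_ofReal g.L0.le]
  linarith

/-- gradient of `w` -/
lemma Geo.gradw (g : Geo f L C ε) (hu : RoughSolution f L C ε u) :
    IntegrableOn (fun p : ℝ × ℝ => pd1 u p.1 p.2 ^ 2
      + (pd2 u p.1 p.2 - C / 2 * (1 - 2 * p.2)) ^ 2) (OmegaEps f L ε) ∧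
    ∫ p in OmegaEps f L ε, (pd1 u p.1 p.2 ^ 2 + (pd2 u p.1 p.2 - C / 2 * (1 - 2 * p.2)) ^ 2)
      ≤ 3 / 2 * C ^ 2 * ε * L := by
  have e : (fun p : ℝ × ℝ => pd1 u p.1 p.2 ^ 2 + (pd2 u p.1 p.2 - C / 2 * (1 - 2 * p.2)) ^ 2)
      = fun p => (gradSq u p.1 p.2 + Hf C u p) +
        (C * (C / 2 * (p.2 - p.2 ^ 2)) - 2 * C * u p.1 p.2) := by
    funext p; unfold gradSq Hf; ring
  have iA := hu.energy.add (g.intH hu)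
  have iB := (g.intU.const_mul C).sub ((g.intu hu).const_mul (2 * C))
  rw [e]
  refine ⟨iA.add iB, ?_⟩
  have e2 := integral_add iA iB
  have e3 := integral_add hu.energy (g.intH hu)
  have e4 := integral_sub (g.intU.const_mul C) ((g.intu hu).const_mul (2 * C))
  simp only [Pi.add_apply, Pi.sub_apply] at e2 e3 e4
  rw [e2, e3, e4, integral_const_mul C, integral_const_mul (2 * C)]
  have h1 := g.energyLe hu
  have h2 := g.intHle hu
  have h3 : ∫ p in OmegaEps f L ε, C / 2 * (p.2 - p.2 ^ 2) ≤ ∫ p in OmegaEps f L ε, u p.1 p.2 :=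
    setIntegral_mono_on g.intU (g.intu hu) g.openOm.measurableSet
      fun p hp => (g.bounds hu p hp).2.1
  nlinarith [mul_le_mul_of_nonneg_left h3 g.C0.le]

end

lemma u01_deriv (C x y : ℝ) :
    HasDerivAt (fun t => u01 C x t) (if 0 ≤ y then C / 2 * (1 - 2 * y) else C / 2) y := by
  have hA : HasDerivAt (fun t : ℝ => C / 2 * (1 - t) * t) (C / 2 * (1 - 2 * y)) y := by
    have := (((hasDerivAt_id' y).const_sub 1).const_mul (C / 2)).mul (hasDerivAt_id' y)
    exact this.congr_deriv (by ring)
  have hB : HasDerivAt (fun t : ℝ => C / 2 * t) (C / 2) y := by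
    simpa using (hasDerivAt_id' y).const_mul (C / 2)
  rcases lt_trichotomy y 0 with h | h | h
  · rw [if_neg (not_le.2 h)]
    apply hB.congr_of_eventuallyEq
    filter_upwards [Iio_mem_nhds h] with t ht
    simp [u01, not_le.2 (show t < 0 from ht)]
  · subst h
    rw [if_pos le_rfl]
    have h1 : HasDerivWithinAt (fun t => u01 C x t) (C / 2 * (1 - 2 * 0)) (Ici 0) 0 :=
      hA.hasDerivWithinAt.congr (fun t ht => by simp [u01, show (0 : ℝ) ≤ t from ht])
        (by simp [u01])
    have h2 : HasDerivWithinAt (fun t => u01 C x t) (C / 2 * (1 - 2 * 0)) (Iic 0) 0 := by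
      have := hB.hasDerivWithinAt (s := Iic 0)
      refine (this.congr_deriv (by ring)).congr (fun t ht => ?_) (by simp [u01])
      rcases eq_or_lt_of_le (show t ≤ 0 from ht) with h | h
      · simp [u01, h]
      · simp [u01, not_le.2 h]
    have := h1.union h2
    rwa [union_comm, Iic_union_Ici, hasDerivWithinAt_univ] at this
  · rw [if_pos h.le]
    apply hA.congr_of_eventuallyEq
    filter_upwards [Ioi_mem_nhds h] with t ht
    simp [u01, (show 0 < t from ht).le]

theorem zeroth_order_error_estimates
    (f : ℝ → ℝ) (K : NNReal) (δ L C : ℝ)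
    (hf : LipschitzWith K f) (hper : Function.Periodic f (2 * π))
    (hδ0 : 0 < δ) (hδ1 : δ < 1) (hfb : ∀ t, -1 ≤ f t ∧ f t ≤ -δ)
    (hL : 0 < L) (hC : 0 < C) :
    ∃ c₁ > (0 : ℝ), ∃ c₂ > (0 : ℝ), ∀ ε : ℝ, 0 < ε → ε ≤ 1 →
      (∃ N : ℕ, 0 < N ∧ L = 2 * π * ε * N) →
      ∀ u : ℝ → ℝ → ℝ, RoughSolution f L C ε u →
        Real.sqrt (∫ p in OmegaEps f L ε,
            ((u p.1 p.2 - u01 C p.1 p.2) ^ 2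
              + gradSq (fun x y => u x y - u01 C x y) p.1 p.2))
          ≤ c₁ * Real.sqrt ε ∧
        Real.sqrt (∫ p in Omega0 L, (u p.1 p.2 - u01 C p.1 p.2) ^ 2) ≤ c₂ * ε := by
  refine ⟨3 * C * Real.sqrt L, by positivity, C * Real.sqrt L, by positivity, ?_⟩
  rintro ε he he1 ⟨N, hN, hLN⟩ u hu
  have g : Geo f L C ε := ⟨hf.continuous, fun t => ⟨(hfb t).1, by linarith [(hfb t).2]⟩, hL, hC,
    he, he1, fun x => by
      have h1 : (x + L) / ε = x / ε + N * (2 * π) := by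
        rw [hLN]; field_simp
      rw [h1]
      exact hper.nat_mul N _⟩
  have hOm := g.openOm.measurableSet
  constructor
  · have hbd : ∫ p in OmegaEps f L ε, ((u p.1 p.2 - u01 C p.1 p.2) ^ 2
        + gradSq (fun x y => u x y - u01 C x y) p.1 p.2) ≤ 9 * C ^ 2 * L * ε := by
      obtain ⟨iw, hw⟩ := g.gradw hu
      obtain ⟨_, d2⟩ := pd2_reg (n := 1) g.openS (by simpa [one_add_one_eq_two] using hu.smooth)
      have ic : IntegrableOn (fun _ : ℝ × ℝ => 3 * C ^ 2 * ε) (OmegaEps f L ε) :=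
        g.intBdd continuousOn_const (|3 * C ^ 2 * ε|) (fun _ _ => le_rfl)
      have iR := ic.add (iw.const_mul 2)
      have hle : ∫ p in OmegaEps f L ε, ((u p.1 p.2 - u01 C p.1 p.2) ^ 2
          + gradSq (fun x y => u x y - u01 C x y) p.1 p.2)
          ≤ ∫ p in OmegaEps f L ε, (3 * C ^ 2 * ε + 2 * (pd1 u p.1 p.2 ^ 2
            + (pd2 u p.1 p.2 - C / 2 * (1 - 2 * p.2)) ^ 2)) := by
        refine integral_mono_of_nonneg ?_ iR ?_
        · refine Filter.Eventually.of_forall fun p => ?_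
          simp only [Pi.zero_apply, gradSq]
          positivity
        · refine (ae_restrict_iff' hOm).2 (Filter.Eventually.of_forall fun p hp => ?_)
          have e1 : pd1 (fun x y => u x y - u01 C x y) p.1 p.2 = pd1 u p.1 p.2 := by
            unfold pd1
            have : ∀ t, u01 C t p.2 = u01 C 0 p.2 := fun t => rfl
            simp only [this]
            exact deriv_sub_const _
          have e2 : pd2 (fun x y => u x y - u01 C x y) p.1 p.2 = pd2 u p.1 p.2 -
              (if 0 ≤ p.2 then C / 2 * (1 - 2 * p.2) else C / 2) :=
            ((d2 p (g.subS hp)).sub (u01_deriv C p.1 p.2)).deriv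
          simp only [gradSq]
          rw [e1, e2]
          obtain ⟨b0, b1, b2⟩ := g.bounds hu p hp
          have y0 : -ε ≤ p.2 := by linarith [g.gge p.1, hp.2.2.1]
          have hCe : (C * ε) ^ 2 ≤ C ^ 2 * ε := by
            have : ε ^ 2 ≤ ε := by nlinarith
            nlinarith [mul_le_mul_of_nonneg_left this (sq_nonneg C)]
          generalize u p.1 p.2 = U at *
          generalize pd1 u p.1 p.2 = a at *
          generalize pd2 u p.1 p.2 = b at *
          generalize p.2 = y at *
          unfold u01
          by_cases hy : 0 ≤ y
          · simp only [if_pos hy]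
            have : (U - C / 2 * (1 - y) * y) ^ 2 ≤ (C * ε) ^ 2 := by
              apply sq_le_sq' <;> nlinarith
            nlinarith [sq_nonneg a, sq_nonneg (b - C / 2 * (1 - 2 * y)), sq_nonneg (C * ε)]
          · simp only [if_neg hy]
            rw [not_le] at hy
            have hy2 : y ^ 2 ≤ ε := by nlinarith
            have hCy := mul_le_mul_of_nonneg_left hy2 hC.le
            have : (U - C / 2 * y) ^ 2 ≤ (C * ε) ^ 2 := by
              apply sq_le_sq' <;> nlinarith [mul_nonneg hC.le (sq_nonneg y)]
            have h3 : (C * y) ^ 2 ≤ (C * ε) ^ 2 := by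
              apply sq_le_sq' <;> nlinarith
            nlinarith [sq_nonneg a, sq_nonneg (b - C / 2 * (1 - 2 * y) + C * y)]
      refine hle.trans ?_
      have e := integral_add ic (iw.const_mul 2)

      rw [e, integral_const_mul (2 : ℝ), setIntegral_const, smul_eq_mul]
      have hv : volume.real (OmegaEps f L ε) ≤ 2 * L := by
        have := ENNReal.toReal_mono ENNReal.ofReal_ne_top g.vol
        rwa [ENNReal.toReal_ofReal (by linarith)] at this
      nlinarith [mul_le_mul_of_nonneg_right hv (by positivity : 0 ≤ 3 * C ^ 2 * ε)]
    calc _ ≤ Real.sqrt (9 * C ^ 2 * L * ε) := Real.sqrt_le_sqrt hbd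
      _ = 3 * C * Real.sqrt L * Real.sqrt ε := by
        rw [show 9 * C ^ 2 * L * ε = (3 * C) ^ 2 * (L * ε) by ring,
          Real.sqrt_mul (sq_nonneg _), Real.sqrt_sq (by positivity), Real.sqrt_mul hL.le]
        ring
  · have hsub : Omega0 L ⊆ OmegaEps f L ε := by
      rintro p ⟨h1, h2⟩
      exact ⟨h1.1, h1.2, (g.glt p.1).trans h2.1, h2.2⟩
    have hm : MeasurableSet (Omega0 L) := measurableSet_Ioo.prod measurableSet_Ioo
    have hvol : volume (Omega0 L) = ENNReal.ofReal L := by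
      rw [Omega0, Measure.volume_eq_prod, Measure.prod_prod, Real.volume_Ioo, Real.volume_Ioo]
      simp
    have hbd : ∫ p in Omega0 L, (u p.1 p.2 - u01 C p.1 p.2) ^ 2 ≤ (C * ε) ^ 2 * L := by
      have hle : ∫ p in Omega0 L, (u p.1 p.2 - u01 C p.1 p.2) ^ 2
          ≤ ∫ p in Omega0 L, (C * ε) ^ 2 := by
        refine integral_mono_of_nonneg ?_ (integrableOn_const (by simp [hvol])) ?_
        · refine Filter.Eventually.of_forall fun p => ?_
          simp only [Pi.zero_apply]
          positivity
        · refine (ae_restrict_iff' hm).2 (Filter.Eventually.of_forall fun p hp => ?_)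
          obtain ⟨b0, b1, b2⟩ := g.bounds hu p (hsub hp)
          have hy : 0 ≤ p.2 := hp.2.1.le
          simp only [u01, if_pos hy]
          have := mul_pos hC he
          apply sq_le_sq' <;> nlinarith
      refine hle.trans ?_
      rw [setIntegral_const, smul_eq_mul, Measure.real, hvol, ENNReal.toReal_ofReal hL.le, mul_comm]
    calc _ ≤ Real.sqrt ((C * ε) ^ 2 * L) := Real.sqrt_le_sqrt hbd
      _ = C * Real.sqrt L * ε := by
        rw [Real.sqrt_mul (sq_nonneg _), Real.sqrt_sq (by positivity)]
        ring

end
end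

section
/- For every α ∈ (0,2) one has the weighted exponential-decay estimate ∫_{(0,2π)×(0,∞)} |u(y) − ū|² e^{α y₂} dy ≤ (1/(2−α)) ∫_{(0,2π)×(0,∞)} |∇u|² dy. (This is the weighted L² decay of Proposition A.4, quantifying the exponential decay of the boundary-layer corrector towards its interface average in the y₂ direction.) -/
open MeasureTheory Real Set

noncomputable section

/-- `u` is continuous on the closed upper half plane, `2π`-periodic in `y₁`, harmonic in the
open upper half plane and with finite Dirichlet energy over one period. -/
structure UpperHarmonic (u : ℝ → ℝ → ℝ) : Prop where
  cont : ContinuousOn (fun p : ℝ × ℝ => u p.1 p.2) {p : ℝ × ℝ | 0 ≤ p.2}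
  periodic : ∀ y₁ y₂, u (y₁ + 2 * π) y₂ = u y₁ y₂
  smooth : ContDiffOn ℝ 2 (fun p : ℝ × ℝ => u p.1 p.2) {p : ℝ × ℝ | 0 < p.2}
  harmonic : ∀ p : ℝ × ℝ, 0 < p.2 → lap u p.1 p.2 = 0
  energy : IntegrableOn (fun p : ℝ × ℝ => gradSq u p.1 p.2) (Ioo 0 (2 * π) ×ˢ Ioi 0)


/-- The interface average `ū = (1/2π) ∫₀^{2π} u(t,0) dt`. -/
def interfaceAvg (u : ℝ → ℝ → ℝ) : ℝ := (1 / (2 * π)) * ∫ t in (0 : ℝ)..(2 * π), u t 0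

/-- Wirtinger's inequality. -/
theorem wirtinger_aux (f f' : ℝ → ℝ) (hf : ∀ x, HasDerivAt f (f' x) x) (hf' : Continuous f')
    (hper : f (2 * π) = f 0) (hmean : ∫ x in (0:ℝ)..(2 * π), f x = 0) :
    ∫ x in (0:ℝ)..(2 * π), f x ^ 2 ≤ ∫ x in (0:ℝ)..(2 * π), f' x ^ 2 := by
  have hab : (0:ℝ) < 2 * π := by positivity
  have hfc : Continuous f := continuous_iff_continuousAt.2 fun x => (hf x).continuousAt
  have key : ∀ g : ℝ → ℝ, Continuous g →
      HasSum (fun i => ‖fourierCoeffOn hab (fun x => (g x : ℂ)) i‖ ^ 2)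
        ((2 * π)⁻¹ * ∫ x in (0:ℝ)..(2 * π), g x ^ 2) := by
    intro g hg
    have hL : MemLp (fun x => (g x : ℂ)) 2 (volume.restrict (Ioc 0 (2 * π))) := by
      have hc : Continuous (fun x => (g x : ℂ)) := by fun_prop
      obtain ⟨C, hC⟩ := isCompact_Icc.exists_bound_of_continuousOn (s := Icc 0 (2 * π))
        hc.continuousOn
      refine MemLp.of_bound hc.aestronglyMeasurable C ?_
      filter_upwards [ae_restrict_mem measurableSet_Ioc] with x hx
      exact hC x (Ioc_subset_Icc_self hx)
    have := hasSum_sq_fourierCoeffOn hab hL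
    simpa using this
  have h1 := key f hfc
  have h2 := key f' hf'
  have h3 := hasSum_le (fun i => ?_) h1 h2
  · have : 0 < (2 * π)⁻¹ := by positivity
    exact le_of_mul_le_mul_left h3 this
  · by_cases hi : i = 0
    · subst hi
      have : fourierCoeffOn hab (fun x => (f x : ℂ)) 0 = 0 := by
        rw [fourierCoeffOn_eq_integral]
        simp [intervalIntegral.integral_ofReal, hmean]
      rw [this]; simp
    · have := fourierCoeffOn_of_hasDerivAt hab (f := fun x => (f x : ℂ))
        (f' := fun x => (f' x : ℂ)) hi (fun x _ => (hf x).ofReal_comp)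
        (Continuous.intervalIntegrable (by fun_prop) _ _)
      rw [this]
      simp only [hper, sub_self, mul_zero, zero_sub]
      have hi1 : (1:ℝ) ≤ |(i:ℝ)| := by
        have := Int.one_le_abs hi
        exact_mod_cast this
      have e : ‖(1 / (-2 * π * Complex.I * i) * -(((2 * π : ℝ) - (0:ℝ)) *
          fourierCoeffOn hab (fun x => (f' x : ℂ)) i) : ℂ)‖
          = |(i:ℝ)|⁻¹ * ‖fourierCoeffOn hab (fun x => (f' x : ℂ)) i‖ := by
        have hp := Real.pi_pos
        simp [abs_of_pos hp]
        field_simp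
      rw [e]
      have h4 : |(i:ℝ)|⁻¹ ≤ 1 := inv_le_one_of_one_le₀ hi1
      have h5 : 0 ≤ |(i:ℝ)|⁻¹ := by positivity
      gcongr
      exact mul_le_of_le_one_left (norm_nonneg _) h4

abbrev HP : Set (ℝ × ℝ) := {p : ℝ × ℝ | 0 < p.2}

theorem isOpen_HP : IsOpen HP := isOpen_lt continuous_const continuous_snd

theorem hp_slice_cont {f : ℝ → ℝ → ℝ} (h : ContinuousOn (fun p : ℝ × ℝ => f p.1 p.2) HP)
    {y : ℝ} (hy : 0 < y) : Continuous fun x => f x y := by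
  have : ContinuousOn ((fun p : ℝ × ℝ => f p.1 p.2) ∘ fun x : ℝ => (x, y)) univ :=
    h.comp (by fun_prop) (fun x _ => hy)
  exact continuousOn_univ.1 this

/-- Differentiation under the integral sign. -/
theorem hasDerivAt_param {f f' : ℝ → ℝ → ℝ}
    (hf : ContinuousOn (fun p : ℝ × ℝ => f p.1 p.2) HP)
    (hf' : ContinuousOn (fun p : ℝ × ℝ => f' p.1 p.2) HP)
    (hd : ∀ x y, 0 < y → HasDerivAt (fun t => f x t) (f' x y) y) {y : ℝ} (hy : 0 < y) :
    HasDerivAt (fun y => ∫ x in (0:ℝ)..(2 * π), f x y) (∫ x in (0:ℝ)..(2 * π), f' x y) y := by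
  have hK : IsCompact (Icc (0:ℝ) (2 * π) ×ˢ Icc (y / 2) (2 * y)) :=
    isCompact_Icc.prod isCompact_Icc
  obtain ⟨C, hC⟩ := hK.exists_bound_of_continuousOn (f := fun p : ℝ × ℝ => f' p.1 p.2)
    (hf'.mono (by rintro ⟨a, b⟩ ⟨_, hb⟩; have := hb.1; simp at this ⊢; linarith))
  have hs : Icc (y / 2) (2 * y) ∈ nhds y := Icc_mem_nhds (by linarith) (by linarith)
  refine (intervalIntegral.hasDerivAt_integral_of_dominated_loc_of_deriv_le
    (F := fun y x => f x y) (F' := fun y x => f' x y) (bound := fun _ => C) hs ?_ ?_ ?_ ?_ ?_ ?_).2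
  · filter_upwards [Ioi_mem_nhds hy] with z hz
    exact (hp_slice_cont hf hz).aestronglyMeasurable
  · exact (hp_slice_cont hf hy).intervalIntegrable _ _
  · exact (hp_slice_cont hf' hy).aestronglyMeasurable
  · refine Filter.Eventually.of_forall fun t ht z hz => hC (t, z) ⟨?_, hz⟩
    rw [uIoc_of_le (by positivity)] at ht
    exact ⟨ht.1.le, ht.2⟩
  · simp
  · refine Filter.Eventually.of_forall fun t ht z hz => hd t z ?_
    have := hz.1
    linarith

theorem hp_fderiv {f : ℝ → ℝ → ℝ} (h : ContDiffOn ℝ 1 (fun p : ℝ × ℝ => f p.1 p.2) HP)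
    (x : ℝ) {y : ℝ} (hy : 0 < y) :
    HasFDerivAt (fun p : ℝ × ℝ => f p.1 p.2) (fderiv ℝ (fun p : ℝ × ℝ => f p.1 p.2) (x, y)) (x, y) :=
  ((h.differentiableOn (by norm_num)).differentiableAt (isOpen_HP.mem_nhds hy)).hasFDerivAt

theorem hp_deriv1' {f : ℝ → ℝ → ℝ} (h : ContDiffOn ℝ 1 (fun p : ℝ × ℝ => f p.1 p.2) HP)
    (x : ℝ) {y : ℝ} (hy : 0 < y) : HasDerivAt (fun t => f t y)
      (fderiv ℝ (fun p : ℝ × ℝ => f p.1 p.2) (x, y) (1, 0)) x := by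
  have h2 : HasDerivAt (fun t : ℝ => (t, y)) ((1:ℝ), (0:ℝ)) x :=
    (hasDerivAt_id x).prodMk (hasDerivAt_const x y)
  exact HasFDerivAt.comp_hasDerivAt (f := fun t : ℝ => (t, y)) x (hp_fderiv h x hy) h2

theorem hp_deriv2' {f : ℝ → ℝ → ℝ} (h : ContDiffOn ℝ 1 (fun p : ℝ × ℝ => f p.1 p.2) HP)
    (x : ℝ) {y : ℝ} (hy : 0 < y) : HasDerivAt (fun t => f x t)
      (fderiv ℝ (fun p : ℝ × ℝ => f p.1 p.2) (x, y) (0, 1)) y := by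
  have h2 : HasDerivAt (fun t : ℝ => (x, t)) ((0:ℝ), (1:ℝ)) y :=
    (hasDerivAt_const y x).prodMk (hasDerivAt_id y)
  exact HasFDerivAt.comp_hasDerivAt (f := fun t : ℝ => (x, t)) y (hp_fderiv h x hy) h2

theorem hp_deriv1 {f : ℝ → ℝ → ℝ} (h : ContDiffOn ℝ 1 (fun p : ℝ × ℝ => f p.1 p.2) HP)
    (x : ℝ) {y : ℝ} (hy : 0 < y) : HasDerivAt (fun t => f t y) (pd1 f x y) x := by
  unfold pd1; rw [(hp_deriv1' h x hy).deriv]; exact hp_deriv1' h x hy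

theorem hp_deriv2 {f : ℝ → ℝ → ℝ} (h : ContDiffOn ℝ 1 (fun p : ℝ × ℝ => f p.1 p.2) HP)
    (x : ℝ) {y : ℝ} (hy : 0 < y) : HasDerivAt (fun t => f x t) (pd2 f x y) y := by
  unfold pd2; rw [(hp_deriv2' h x hy).deriv]; exact hp_deriv2' h x hy

theorem hp_contDiff1 {f : ℝ → ℝ → ℝ} {m n : WithTop ℕ∞} (hmn : m + 1 ≤ n)
    (h : ContDiffOn ℝ n (fun p : ℝ × ℝ => f p.1 p.2) HP) :
    ContDiffOn ℝ m (fun p : ℝ × ℝ => pd1 f p.1 p.2) HP := by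
  have h1 := h.fderiv_of_isOpen isOpen_HP hmn
  have h2 : ContDiffOn ℝ m
    (fun p => fderiv ℝ (fun p : ℝ × ℝ => f p.1 p.2) p ((1:ℝ), (0:ℝ))) HP :=
    h1.clm_apply contDiffOn_const
  refine h2.congr fun p hp => ?_
  exact (hp_deriv1' (h.of_le (le_trans (by simp) hmn)) p.1 hp).deriv

theorem hp_contDiff2 {f : ℝ → ℝ → ℝ} {m n : WithTop ℕ∞} (hmn : m + 1 ≤ n)
    (h : ContDiffOn ℝ n (fun p : ℝ × ℝ => f p.1 p.2) HP) :
    ContDiffOn ℝ m (fun p : ℝ × ℝ => pd2 f p.1 p.2) HP := by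
  have h1 := h.fderiv_of_isOpen isOpen_HP hmn
  have h2 : ContDiffOn ℝ m
    (fun p => fderiv ℝ (fun p : ℝ × ℝ => f p.1 p.2) p ((0:ℝ), (1:ℝ))) HP :=
    h1.clm_apply contDiffOn_const
  refine h2.congr fun p hp => ?_
  exact (hp_deriv2' (h.of_le (le_trans (by simp) hmn)) p.1 hp).deriv

theorem hp_symm {f : ℝ → ℝ → ℝ} (h : ContDiffOn ℝ 2 (fun p : ℝ × ℝ => f p.1 p.2) HP)
    (x : ℝ) {y : ℝ} (hy : 0 < y) : pd1 (pd2 f) x y = pd2 (pd1 f) x y := by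
  set g := fun p : ℝ × ℝ => f p.1 p.2 with hg
  have h1 : ContDiffOn ℝ 1 g HP := h.of_le (by norm_num)
  have hat : ContDiffAt ℝ 2 g (x, y) := h.contDiffAt (isOpen_HP.mem_nhds hy)
  have hsym : IsSymmSndFDerivAt ℝ g (x, y) := hat.isSymmSndFDerivAt (by simp)
  have hdd : HasFDerivAt (fderiv ℝ g) (fderiv ℝ (fderiv ℝ g) (x, y)) (x, y) :=
    ((hat.fderiv_right (m := 1) (by norm_num)).differentiableAt (by norm_num)).hasFDerivAt
  have a1 : HasDerivAt (fun t => pd2 f t y) (fderiv ℝ (fderiv ℝ g) (x, y) (1, 0) (0, 1)) x := by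
    have h2 : HasDerivAt (fun t : ℝ => (t, y)) ((1:ℝ), (0:ℝ)) x :=
      (hasDerivAt_id x).prodMk (hasDerivAt_const x y)
    have h3 := (HasFDerivAt.comp_hasDerivAt (f := fun t : ℝ => (t, y)) x hdd h2).clm_apply
      (hasDerivAt_const x ((0:ℝ), (1:ℝ)))
    simp only [map_zero, add_zero, Function.comp_def] at h3
    refine h3.congr_of_eventuallyEq (Filter.Eventually.of_forall fun t => ?_)
    exact (hp_deriv2' h1 t hy).deriv
  have a2 : HasDerivAt (fun t => pd1 f x t) (fderiv ℝ (fderiv ℝ g) (x, y) (0, 1) (1, 0)) y := by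
    have h2 : HasDerivAt (fun t : ℝ => (x, t)) ((0:ℝ), (1:ℝ)) y :=
      (hasDerivAt_const y x).prodMk (hasDerivAt_id y)
    have h3 := (HasFDerivAt.comp_hasDerivAt (f := fun t : ℝ => (x, t)) y hdd h2).clm_apply
      (hasDerivAt_const y ((1:ℝ), (0:ℝ)))
    simp only [map_zero, add_zero, Function.comp_def] at h3
    refine h3.congr_of_eventuallyEq ?_
    filter_upwards [Ioi_mem_nhds hy] with t ht
    exact (hp_deriv1' h1 x ht).deriv
  have b1 : pd1 (pd2 f) x y = _ := a1.deriv
  have b2 : pd2 (pd1 f) x y = _ := a2.deriv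
  rw [b1, b2]
  exact hsym.eq _ _

theorem const_nonpos_of_integrable {c a : ℝ} {f : ℝ → ℝ} (hf : IntegrableOn f (Ioi a))
    (h : ∀ y, a < y → c ≤ f y) : c ≤ 0 := by
  by_contra hc
  push Not at hc
  have : IntegrableOn (fun _ : ℝ => c) (Ioi a) := by
    refine Integrable.mono' hf (by fun_prop) ?_
    filter_upwards [ae_restrict_mem measurableSet_Ioi] with y hy
    rw [Real.norm_eq_abs, abs_of_pos hc]; exact h y hy
  rw [integrableOn_const_iff] at this
  rcases this with h | h
  · rw [enorm_eq_zero] at h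
    linarith
  · simp at h

/-- The ODE part of the argument. -/
theorem ode_part {F F1 G : ℝ → ℝ} (hF : ContinuousOn F (Ici 0))
    (hd : ∀ y, 0 < y → HasDerivAt F (F1 y) y)
    (hd1 : ∀ y, 0 < y → HasDerivAt F1 (2 * G y) y)
    (hFG : ∀ y, 0 < y → 2 * F y ≤ G y) (hF1G : ∀ y, 0 < y → |F1 y| ≤ G y)
    (hG : IntegrableOn G (Ioi 0)) (hGc : ContinuousOn G (Ioi 0)) :
    (∀ y, 0 < y → F y ≤ F 0 * Real.exp (-2 * y)) ∧ F 0 ≤ ∫ y in Ioi 0, G y := by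
  have hneg : ∀ y, 0 < y → F1 y + 2 * F y ≤ 0 := by
    intro a ha
    have hde : ∀ y, 0 < y → HasDerivAt (fun y => Real.exp (-2 * y) * (F1 y + 2 * F y))
        (Real.exp (-2 * y) * (2 * G y - 4 * F y)) y := by
      intro y hy
      have e : HasDerivAt (fun y : ℝ => Real.exp (-2 * y)) (Real.exp (-2 * y) * (-2)) y := by
        have := ((hasDerivAt_id y).const_mul (-2)).exp
        simpa using this
      exact (e.mul ((hd1 y hy).add ((hd y hy).const_mul 2))).congr_deriv (by
        simp only [Pi.add_apply]; ring)
    have hm : MonotoneOn (fun y => Real.exp (-2 * y) * (F1 y + 2 * F y)) (Ioi 0) := by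
      refine monotoneOn_of_deriv_nonneg (convex_Ioi 0)
        (fun y hy => (hde y hy).continuousAt.continuousWithinAt)
        (fun y hy => (hde y (by simpa using hy)).differentiableAt.differentiableWithinAt) ?_
      intro y hy
      have hy' : 0 < y := by simpa using hy
      rw [(hde y hy').deriv]
      have := hFG y hy'
      exact mul_nonneg (Real.exp_pos _).le (by linarith)
    by_contra hc
    push Not at hc
    have : F1 a + 2 * F a ≤ 0 := by
      refine const_nonpos_of_integrable (a := a) (f := fun y => 2 * G y)
        ((hG.mono_set (Ioi_subset_Ioi ha.le)).const_mul 2) ?_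
      intro y hy
      have h1 := hm ha (ha.trans hy) hy.le
      simp only at h1
      have h2 := hFG y (ha.trans hy)
      have h3 := (le_abs_self _).trans (hF1G y (ha.trans hy))
      have h4 : Real.exp (-2 * y) ≤ Real.exp (-2 * a) := Real.exp_le_exp.2 (by linarith)
      have h5 : Real.exp (-2 * y) * (F1 a + 2 * F a) ≤ Real.exp (-2 * y) * (F1 y + 2 * F y) :=
        (mul_le_mul_of_nonneg_right h4 hc.le).trans h1
      have h6 := le_of_mul_le_mul_left h5 (Real.exp_pos _)
      linarith
    linarith
  have hdec : ∀ y, 0 < y → F y ≤ F 0 * Real.exp (-2 * y) := by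
    intro a ha
    have hde : ∀ y, 0 < y → HasDerivAt (fun y => Real.exp (2 * y) * F y)
        (Real.exp (2 * y) * (F1 y + 2 * F y)) y := by
      intro y hy
      have e : HasDerivAt (fun y : ℝ => Real.exp (2 * y)) (Real.exp (2 * y) * 2) y := by
        have := ((hasDerivAt_id y).const_mul 2).exp
        simpa using this
      exact (e.mul (hd y hy)).congr_deriv (by ring)
    have hm : AntitoneOn (fun y => Real.exp (2 * y) * F y) (Ici 0) := by
      refine antitoneOn_of_deriv_nonpos (convex_Ici 0)
        (ContinuousOn.mul (by fun_prop) hF)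
        (fun y hy => (hde y (by simpa using hy)).differentiableAt.differentiableWithinAt) ?_
      intro y hy
      have hy' : 0 < y := by simpa using hy
      rw [(hde y hy').deriv]
      exact mul_nonpos_of_nonneg_of_nonpos (Real.exp_pos _).le (hneg y hy')
    have h1 := hm (mem_Ici.2 le_rfl) (mem_Ici.2 ha.le) ha.le
    simp only [mul_zero, Real.exp_zero, one_mul] at h1
    have h2 : Real.exp (2 * a) * Real.exp (-2 * a) = 1 := by
      rw [← Real.exp_add]; simp
    calc F a = (Real.exp (2 * a) * F a) * Real.exp (-2 * a) := by
          linear_combination (-F a) * h2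
      _ ≤ _ := mul_le_mul_of_nonneg_right h1 (Real.exp_pos _).le
  refine ⟨hdec, ?_⟩
  have hG0 : ∀ y, 0 < y → 0 ≤ G y := fun y hy => (abs_nonneg _).trans (hF1G y hy)
  have hint : ∀ y, 0 ≤ y → IntervalIntegrable G volume 0 y := fun y hy =>
    (intervalIntegrable_iff_integrableOn_Ioc_of_le hy).2 (hG.mono_set Ioc_subset_Ioi_self)
  have hK : ∀ a, 0 < a → F 0 ≤ F a + ∫ y in Ioi 0, G y := by
    intro a ha
    have hde : ∀ y, 0 < y → HasDerivAt (fun y => F y + ∫ t in (0:ℝ)..y, G t) (F1 y + G y) y := by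
      intro y hy
      refine (hd y hy).add (intervalIntegral.integral_hasDerivAt_right (hint y hy.le) ?_
        (hGc.continuousAt (Ioi_mem_nhds hy)))
      exact hGc.stronglyMeasurableAtFilter isOpen_Ioi y hy
    have hm : MonotoneOn (fun y => F y + ∫ t in (0:ℝ)..y, G t) (Icc 0 a) := by
      refine monotoneOn_of_deriv_nonneg (convex_Icc 0 a)
        (ContinuousOn.add (hF.mono Icc_subset_Ici_self) ?_)
        (fun y hy => (hde y (by simp at hy; exact hy.1)).differentiableAt.differentiableWithinAt) ?_
      · have := intervalIntegral.continuousOn_primitive_interval (μ := volume) (f := G) (a := 0)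
          (b := a) ?_
        · rwa [uIcc_of_le ha.le] at this
        · rw [uIcc_of_le ha.le]
          exact (integrableOn_Icc_iff_integrableOn_Ioc).2 (hG.mono_set Ioc_subset_Ioi_self)
      intro y hy
      have hy' : 0 < y := by simp at hy; exact hy.1
      rw [(hde y hy').deriv]
      have := hF1G y hy'
      have := neg_abs_le (F1 y)
      linarith
    have h1 := hm (left_mem_Icc.2 ha.le) (right_mem_Icc.2 ha.le) ha.le
    simp only [intervalIntegral.integral_same, add_zero] at h1
    refine h1.trans (add_le_add le_rfl ?_)
    rw [intervalIntegral.integral_of_le ha.le]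
    refine setIntegral_mono_set hG ?_ (Filter.Eventually.of_forall Ioc_subset_Ioi_self)
    filter_upwards [ae_restrict_mem measurableSet_Ioi] with y hy using hG0 y hy
  have hlim : Filter.Tendsto (fun y => F 0 * Real.exp (-2 * y) + ∫ y in Ioi 0, G y) Filter.atTop
      (nhds (F 0 * 0 + ∫ y in Ioi 0, G y)) := by
    refine Filter.Tendsto.add (Filter.Tendsto.const_mul _ ?_) tendsto_const_nhds
    refine Real.tendsto_exp_atBot.comp ?_
    exact Filter.tendsto_id.const_mul_atTop_of_neg (by norm_num)
  have := ge_of_tendsto hlim (b := F 0) ?_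
  · simpa using this
  · filter_upwards [Filter.eventually_gt_atTop 0] with y hy
    exact (hK y hy).trans (add_le_add (hdec y hy) le_rfl)

theorem const_of_hasDerivAt_zero {D : Set ℝ} (hD : Convex ℝ D) {f : ℝ → ℝ}
    (hf : ContinuousOn f D) (h : ∀ y ∈ interior D, HasDerivAt f 0 y) {a b : ℝ}
    (ha : a ∈ D) (hb : b ∈ D) (hab : a ≤ b) : f a = f b := by
  have hd : DifferentiableOn ℝ f (interior D) :=
    fun y hy => (h y hy).differentiableAt.differentiableWithinAt
  refine le_antisymm
    (monotoneOn_of_deriv_nonneg hD hf hd (fun y hy => (h y hy).deriv.ge) ha hb hab)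
    (antitoneOn_of_deriv_nonpos hD hf hd (fun y hy => (h y hy).deriv.le) ha hb hab)

theorem const_of_hasDerivAt_zero_Ioi {f : ℝ → ℝ}
    (h : ∀ y, 0 < y → HasDerivAt f 0 y) {a b : ℝ}
    (ha : 0 < a) (hb : 0 < b) : f a = f b := by
  have key : ∀ {a b : ℝ}, 0 < a → a ≤ b → f a = f b := fun {a b} ha hab =>
    const_of_hasDerivAt_zero (convex_Ioi 0)
      (fun y hy => (h y hy).continuousAt.continuousWithinAt)
      (fun y hy => h y (by simpa using hy)) ha (lt_of_lt_of_le ha hab) hab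
  rcases le_total a b with hab | hab
  · exact key ha hab
  · exact (key hb hab).symm

theorem intervalIntegral_deriv_periodic {f f' : ℝ → ℝ} (hd : ∀ x, HasDerivAt f (f' x) x)
    (hf' : Continuous f') (hper : f (2 * π) = f 0) : ∫ x in (0:ℝ)..(2 * π), f' x = 0 := by
  rw [intervalIntegral.integral_eq_sub_of_hasDerivAt (fun x _ => hd x)
    (hf'.intervalIntegrable _ _), hper, sub_self]

namespace UpperHarmonic

variable {u : ℝ → ℝ → ℝ}

theorem smooth1 (hu : UpperHarmonic u) : ContDiffOn ℝ 1 (fun p : ℝ × ℝ => u p.1 p.2) HP :=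
  hu.smooth.of_le (by norm_num)

theorem smooth_pd1 (hu : UpperHarmonic u) :
    ContDiffOn ℝ 1 (fun p : ℝ × ℝ => pd1 u p.1 p.2) HP :=
  hp_contDiff1 (n := 2) (by norm_num) hu.smooth

theorem smooth_pd2 (hu : UpperHarmonic u) :
    ContDiffOn ℝ 1 (fun p : ℝ × ℝ => pd2 u p.1 p.2) HP :=
  hp_contDiff2 (n := 2) (by norm_num) hu.smooth

theorem c0 (hu : UpperHarmonic u) : ContinuousOn (fun p : ℝ × ℝ => u p.1 p.2) HP :=
  hu.smooth1.continuousOn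
theorem c1 (hu : UpperHarmonic u) : ContinuousOn (fun p : ℝ × ℝ => pd1 u p.1 p.2) HP :=
  hu.smooth_pd1.continuousOn
theorem c2 (hu : UpperHarmonic u) : ContinuousOn (fun p : ℝ × ℝ => pd2 u p.1 p.2) HP :=
  hu.smooth_pd2.continuousOn
theorem c11 (hu : UpperHarmonic u) :
    ContinuousOn (fun p : ℝ × ℝ => pd1 (pd1 u) p.1 p.2) HP :=
  (hp_contDiff1 (m := 0) (n := 1) (by norm_num) hu.smooth_pd1).continuousOn
theorem c12 (hu : UpperHarmonic u) :
    ContinuousOn (fun p : ℝ × ℝ => pd2 (pd1 u) p.1 p.2) HP :=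
  (hp_contDiff2 (m := 0) (n := 1) (by norm_num) hu.smooth_pd1).continuousOn
theorem c22 (hu : UpperHarmonic u) :
    ContinuousOn (fun p : ℝ × ℝ => pd2 (pd2 u) p.1 p.2) HP :=
  (hp_contDiff2 (m := 0) (n := 1) (by norm_num) hu.smooth_pd2).continuousOn

theorem per1 (hu : UpperHarmonic u) (y : ℝ) : pd1 u (2 * π) y = pd1 u 0 y := by
  unfold pd1
  have h : (fun t => u (t + 2 * π) y) = fun t => u t y := by
    funext t; exact hu.periodic t y
  have := deriv_comp_add_const (f := fun t => u t y) (2 * π) 0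
  rw [zero_add] at this
  rw [← this, h]

theorem per0 (hu : UpperHarmonic u) (y : ℝ) : u (2 * π) y = u 0 y := by
  simpa using hu.periodic 0 y

theorem per2 (hu : UpperHarmonic u) (y : ℝ) : pd2 u (2 * π) y = pd2 u 0 y := by
  unfold pd2
  simp only [hu.per0]

theorem harm (hu : UpperHarmonic u) (x : ℝ) {y : ℝ} (hy : 0 < y) :
    pd2 (pd2 u) x y = - pd1 (pd1 u) x y := by
  have := hu.harmonic (x, y) hy
  simp only [lap] at this
  linarith

theorem cont_gradSq (hu : UpperHarmonic u) :
    ContinuousOn (fun p : ℝ × ℝ => gradSq u p.1 p.2) HP := by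
  unfold gradSq
  exact (hu.c1.pow 2).add (hu.c2.pow 2)

theorem gradInt (hu : UpperHarmonic u) {y : ℝ} (hy : 0 < y) :
    ∫ x in (0:ℝ)..(2 * π), gradSq u x y =
      (∫ x in (0:ℝ)..(2 * π), (pd1 u x y) ^ 2) + ∫ x in (0:ℝ)..(2 * π), (pd2 u x y) ^ 2 := by
  unfold gradSq
  exact intervalIntegral.integral_add
    (((hp_slice_cont hu.c1 hy).pow 2).intervalIntegrable _ _)
    (((hp_slice_cont hu.c2 hy).pow 2).intervalIntegrable _ _)

theorem sq_int_nonneg (f : ℝ → ℝ) : 0 ≤ ∫ x in (0:ℝ)..(2 * π), f x ^ 2 :=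
  intervalIntegral.integral_nonneg (by positivity) (fun _ _ => sq_nonneg _)

theorem energy_prod (hu : UpperHarmonic u) :
    Integrable (fun p : ℝ × ℝ => gradSq u p.1 p.2)
      ((volume.restrict (Ioo 0 (2 * π))).prod (volume.restrict (Ioi 0))) := by
  have := hu.energy
  rwa [IntegrableOn, Measure.volume_eq_prod, ← Measure.prod_restrict] at this

theorem int_Ioo (f : ℝ → ℝ) :
    ∫ x in Ioo (0:ℝ) (2 * π), f x = ∫ x in (0:ℝ)..(2 * π), f x := by
  rw [intervalIntegral.integral_of_le (by positivity), integral_Ioc_eq_integral_Ioo]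

theorem integrable_G (hu : UpperHarmonic u) :
    IntegrableOn (fun y => ∫ x in (0:ℝ)..(2 * π), gradSq u x y) (Ioi 0) := by
  have := hu.energy_prod.integral_prod_right
  simp only [int_Ioo] at this
  exact this

theorem fubini {f : ℝ × ℝ → ℝ} (hf : IntegrableOn f (Ioo 0 (2 * π) ×ˢ Ioi 0)) :
    ∫ p in Ioo (0 : ℝ) (2 * π) ×ˢ Ioi (0 : ℝ), f p =
      ∫ y in Ioi (0:ℝ), ∫ x in (0:ℝ)..(2 * π), f (x, y) := by
  rw [IntegrableOn, Measure.volume_eq_prod, ← Measure.prod_restrict] at hf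
  rw [Measure.volume_eq_prod, ← Measure.prod_restrict, integral_prod_symm _ hf]
  simp only [int_Ioo]

/-- Equipartition of the energy on each horizontal slice. -/
theorem equi (hu : UpperHarmonic u) {y : ℝ} (hy : 0 < y) :
    ∫ x in (0:ℝ)..(2 * π), (pd1 u x y) ^ 2 = ∫ x in (0:ℝ)..(2 * π), (pd2 u x y) ^ 2 := by
  have hd : ∀ y, 0 < y → HasDerivAt
      (fun y => ∫ x in (0:ℝ)..(2 * π), ((pd1 u x y) ^ 2 - (pd2 u x y) ^ 2)) 0 y := by
    intro y hy
    have h1 := hasDerivAt_param (f := fun x y => (pd1 u x y) ^ 2 - (pd2 u x y) ^ 2)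
      (f' := fun x y => 2 * pd1 u x y * pd2 (pd1 u) x y - 2 * pd2 u x y * pd2 (pd2 u) x y)
      ((hu.c1.pow 2).sub (hu.c2.pow 2))
      (((continuousOn_const.mul hu.c1).mul hu.c12).sub ((continuousOn_const.mul hu.c2).mul hu.c22))
      (fun x y hy => (((hp_deriv2 hu.smooth_pd1 x hy).pow 2).sub
        ((hp_deriv2 hu.smooth_pd2 x hy).pow 2)).congr_deriv (by norm_num)) hy
    refine h1.congr_deriv ?_
    refine intervalIntegral_deriv_periodic (f := fun x => 2 * (pd1 u x y * pd2 u x y)) ?_ ?_ ?_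
    · intro x
      refine (((hp_deriv1 hu.smooth_pd1 x hy).mul (hp_deriv1 hu.smooth_pd2 x hy)).const_mul
        2).congr_deriv ?_
      rw [hp_symm hu.smooth x hy, hu.harm x hy]
      ring
    · exact ((continuous_const.mul (hp_slice_cont hu.c1 hy)).mul (hp_slice_cont hu.c12 hy)).sub
        ((continuous_const.mul (hp_slice_cont hu.c2 hy)).mul (hp_slice_cont hu.c22 hy))
    · simp only [hu.per1, hu.per2]
  have hsub : ∀ z, 0 < z → ∫ x in (0:ℝ)..(2 * π), ((pd1 u x z) ^ 2 - (pd2 u x z) ^ 2) =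
      (∫ x in (0:ℝ)..(2 * π), (pd1 u x z) ^ 2) - ∫ x in (0:ℝ)..(2 * π), (pd2 u x z) ^ 2 := by
    intro z hz
    exact intervalIntegral.integral_sub
      (((hp_slice_cont hu.c1 hz).pow 2).intervalIntegrable _ _)
      (((hp_slice_cont hu.c2 hz).pow 2).intervalIntegrable _ _)
  have e1 := hsub y hy
  have k1 := const_nonpos_of_integrable hu.integrable_G
    (c := ∫ x in (0:ℝ)..(2 * π), ((pd1 u x y) ^ 2 - (pd2 u x y) ^ 2)) (fun z hz => by
      rw [hu.gradInt hz]
      have h := const_of_hasDerivAt_zero_Ioi hd hy hz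
      have h2 := hsub z hz
      have := sq_int_nonneg (fun x => pd2 u x z)
      linarith)
  have k2 := const_nonpos_of_integrable hu.integrable_G
    (c := -∫ x in (0:ℝ)..(2 * π), ((pd1 u x y) ^ 2 - (pd2 u x y) ^ 2)) (fun z hz => by
      rw [hu.gradInt hz]
      have h := const_of_hasDerivAt_zero_Ioi hd hy hz
      have h2 := hsub z hz
      have := sq_int_nonneg (fun x => pd1 u x z)
      linarith)
  linarith

theorem cont_ext (hu : UpperHarmonic u) : Continuous (fun p : ℝ × ℝ => u p.1 (max p.2 0)) := by
  have : ContinuousOn ((fun p : ℝ × ℝ => u p.1 p.2) ∘ fun p : ℝ × ℝ => (p.1, max p.2 0)) univ :=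
    hu.cont.comp (by fun_prop) (fun p _ => by simp)
  exact continuousOn_univ.1 this

theorem cont_slice_int (hu : UpperHarmonic u) {g : ℝ → ℝ} (hg : Continuous g) :
    ContinuousOn (fun y => ∫ x in (0:ℝ)..(2 * π), g (u x y)) (Ici 0) := by
  have h1 : Continuous (fun p : ℝ × ℝ => g (u p.2 (max p.1 0))) :=
    hg.comp (hu.cont_ext.comp continuous_swap)
  have h2 : Continuous (fun y => ∫ x in (0:ℝ)..(2 * π), g (u x (max y 0))) :=
    intervalIntegral.continuous_parametric_intervalIntegral_of_continuous'
      (f := fun y x => g (u x (max y 0))) h1 0 (2 * π)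
  refine h2.continuousOn.congr fun y hy => ?_
  simp only [max_eq_left (mem_Ici.1 hy)]

/-- The mean over each horizontal slice is the interface average. -/
theorem mean_const (hu : UpperHarmonic u) {y : ℝ} (hy : 0 < y) :
    ∫ x in (0:ℝ)..(2 * π), u x y = ∫ x in (0:ℝ)..(2 * π), u x 0 := by
  have hM : ∀ y, 0 < y → HasDerivAt (fun y => ∫ x in (0:ℝ)..(2 * π), u x y)
      (∫ x in (0:ℝ)..(2 * π), pd2 u x y) y := fun y hy =>
    hasDerivAt_param hu.c0 hu.c2 (fun x y hy => hp_deriv2 hu.smooth1 x hy) hy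
  have hM1 : ∀ y, 0 < y → HasDerivAt (fun y => ∫ x in (0:ℝ)..(2 * π), pd2 u x y) 0 y := by
    intro y hy
    refine (hasDerivAt_param hu.c2 hu.c22
      (fun x y hy => hp_deriv2 hu.smooth_pd2 x hy) hy).congr_deriv ?_
    refine intervalIntegral_deriv_periodic (f := fun x => - pd1 u x y) ?_
      (hp_slice_cont hu.c22 hy) ?_
    · intro x
      exact (hp_deriv1 hu.smooth_pd1 x hy).neg.congr_deriv (hu.harm x hy).symm
    · simp only [hu.per1]
  have hz : ∀ y, 0 < y → ∫ x in (0:ℝ)..(2 * π), pd2 u x y = 0 := by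
    intro y hy
    set d := ∫ x in (0:ℝ)..(2 * π), pd2 u x y with hd
    have hpi := Real.pi_pos
    have := const_nonpos_of_integrable hu.integrable_G (c := d ^ 2 / (2 * π)) (fun z hz => by
      rw [hu.gradInt hz]
      have h := const_of_hasDerivAt_zero_Ioi hM1 hy hz
      rw [← hd] at h
      have h2 := sq_int_nonneg (fun x => pd1 u x z)
      have h3 := sq_int_nonneg (fun x => pd2 u x z - d / (2 * π))
      have hc := hp_slice_cont hu.c2 hz
      have h4 : ∫ x in (0:ℝ)..(2 * π), (pd2 u x z - d / (2 * π)) ^ 2 =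
          (∫ x in (0:ℝ)..(2 * π), (pd2 u x z) ^ 2) - d ^ 2 / (2 * π) := by
        have e : ∀ x, (pd2 u x z - d / (2 * π)) ^ 2 =
          (pd2 u x z) ^ 2 - ((d / π) * pd2 u x z - (d / (2 * π)) ^ 2) := by
          intro x; field_simp; ring
        simp only [e]
        rw [intervalIntegral.integral_sub (Continuous.intervalIntegrable (by fun_prop) _ _)
          (Continuous.intervalIntegrable (by fun_prop) _ _),
          intervalIntegral.integral_sub (Continuous.intervalIntegrable (by fun_prop) _ _)
          (Continuous.intervalIntegrable (by fun_prop) _ _),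
          intervalIntegral.integral_const_mul, ← h]
        simp only [intervalIntegral.integral_const, smul_eq_mul]
        field_simp
        ring
      linarith)
    have h2 : d ^ 2 ≤ 0 := by
      by_contra hc
      push Not at hc
      have : 0 < d ^ 2 / (2 * π) := by positivity
      linarith
    exact pow_eq_zero_iff (two_ne_zero) |>.1 (le_antisymm h2 (sq_nonneg d))
  refine (const_of_hasDerivAt_zero (convex_Ici 0) (hu.cont_slice_int continuous_id)
    ?_ (mem_Ici.2 le_rfl) (mem_Ici.2 hy.le) hy.le).symm
  intro z hz'
  have hz'' : 0 < z := by simpa using hz'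
  exact (hM z hz'').congr_deriv (hz z hz'')

theorem main_aux (hu : UpperHarmonic u) :
    (∀ y, 0 < y → ∫ x in (0:ℝ)..(2 * π), (u x y - interfaceAvg u) ^ 2 ≤
      (∫ x in (0:ℝ)..(2 * π), (u x 0 - interfaceAvg u) ^ 2) * Real.exp (-2 * y)) ∧
    ∫ x in (0:ℝ)..(2 * π), (u x 0 - interfaceAvg u) ^ 2 ≤
      ∫ y in Ioi (0:ℝ), ∫ x in (0:ℝ)..(2 * π), gradSq u x y := by
  set c := interfaceAvg u with hc
  have hw : ContinuousOn (fun p : ℝ × ℝ => u p.1 p.2 - c) HP := hu.c0.sub continuousOn_const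
  have hW : ∀ y, 0 < y → ∫ x in (0:ℝ)..(2 * π), (u x y - c) ^ 2 ≤
      ∫ x in (0:ℝ)..(2 * π), (pd1 u x y) ^ 2 := by
    intro y hy
    refine wirtinger_aux (fun x => u x y - c) (fun x => pd1 u x y)
      (fun x => (hp_deriv1 hu.smooth1 x hy).sub_const c) (hp_slice_cont hu.c1 hy)
      (by simp only [hu.per0]) ?_
    rw [intervalIntegral.integral_sub ((hp_slice_cont hu.c0 hy).intervalIntegrable _ _)
      (continuous_const.intervalIntegrable _ _), hu.mean_const hy, hc, interfaceAvg]
    have hpi := Real.pi_pos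
    simp only [intervalIntegral.integral_const, smul_eq_mul]
    field_simp
    ring
  refine ode_part (F := fun y => ∫ x in (0:ℝ)..(2 * π), (u x y - c) ^ 2)
    (F1 := fun y => ∫ x in (0:ℝ)..(2 * π), 2 * (u x y - c) * pd2 u x y)
    (G := fun y => ∫ x in (0:ℝ)..(2 * π), gradSq u x y)
    (hu.cont_slice_int (g := fun t => (t - c) ^ 2) (by fun_prop)) ?_ ?_ ?_ ?_ hu.integrable_G ?_
  · intro y hy
    refine hasDerivAt_param (f := fun x y => (u x y - c) ^ 2)
      (f' := fun x y => 2 * (u x y - c) * pd2 u x y) (hw.pow 2)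
      ((continuousOn_const.mul hw).mul hu.c2) ?_ hy
    intro x y hy
    exact (((hp_deriv2 hu.smooth1 x hy).sub_const c).pow 2).congr_deriv (by norm_num)
  · intro y hy
    have h1 := hasDerivAt_param (f := fun x y => 2 * (u x y - c) * pd2 u x y)
      (f' := fun x y => 2 * pd2 u x y * pd2 u x y + 2 * (u x y - c) * pd2 (pd2 u) x y)
      ((continuousOn_const.mul hw).mul hu.c2)
      (((continuousOn_const.mul hu.c2).mul hu.c2).add ((continuousOn_const.mul hw).mul hu.c22))
      (fun x y hy => (((hp_deriv2 hu.smooth1 x hy).sub_const c).const_mul 2).mul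
        (hp_deriv2 hu.smooth_pd2 x hy)) hy
    refine h1.congr_deriv ?_
    have cw := hp_slice_cont (f := fun x y => u x y - c) hw hy
    have s1 := hp_slice_cont hu.c1 hy
    have s2 := hp_slice_cont hu.c2 hy
    have s11 := hp_slice_cont hu.c11 hy
    have s22 := hp_slice_cont hu.c22 hy
    have sg := hp_slice_cont hu.cont_gradSq hy
    have h2 : ∫ x in (0:ℝ)..(2 * π), (2 * ((u x y - c) * pd1 (pd1 u) x y + (pd1 u x y) ^ 2)) = 0 := by
      refine intervalIntegral_deriv_periodic (f := fun x => 2 * ((u x y - c) * pd1 u x y)) ?_ ?_ ?_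
      · intro x
        refine ((((hp_deriv1 hu.smooth1 x hy).sub_const c).mul
          (hp_deriv1 hu.smooth_pd1 x hy)).const_mul 2).congr_deriv ?_
        ring
      · exact continuous_const.mul ((cw.mul s11).add (s1.pow 2))
      · simp only [hu.per0, hu.per1]
    have h3 : ∫ x in (0:ℝ)..(2 * π), (2 * gradSq u x y -
        2 * ((u x y - c) * pd1 (pd1 u) x y + (pd1 u x y) ^ 2)) =
        (∫ x in (0:ℝ)..(2 * π), 2 * gradSq u x y) - ∫ x in (0:ℝ)..(2 * π),
        (2 * ((u x y - c) * pd1 (pd1 u) x y + (pd1 u x y) ^ 2)) :=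
      intervalIntegral.integral_sub ((continuous_const.mul sg).intervalIntegrable _ _)
        ((continuous_const.mul ((cw.mul s11).add (s1.pow 2))).intervalIntegrable _ _)
    rw [h2, sub_zero, intervalIntegral.integral_const_mul] at h3
    rw [← h3]
    refine intervalIntegral.integral_congr fun x _ => ?_
    simp only [hu.harm x hy, gradSq]
    ring
  · intro y hy
    have := hW y hy
    simp only [hu.gradInt hy, ← hu.equi hy]
    linarith
  · intro y hy
    have cw := hp_slice_cont (f := fun x y => u x y - c) hw hy
    have s2 := hp_slice_cont hu.c2 hy
    have h1 : |∫ x in (0:ℝ)..(2 * π), 2 * (u x y - c) * pd2 u x y| ≤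
        ∫ x in (0:ℝ)..(2 * π), ((u x y - c) ^ 2 + (pd2 u x y) ^ 2) := by
      refine (intervalIntegral.abs_integral_le_integral_abs (by positivity)).trans ?_
      refine intervalIntegral.integral_mono_on (by positivity)
        (((continuous_const.mul cw).mul s2).abs.intervalIntegrable _ _)
        (((cw.pow 2).add (s2.pow 2)).intervalIntegrable _ _) fun x _ => ?_
      rw [abs_le]
      constructor
      · nlinarith [sq_nonneg (u x y - c + pd2 u x y)]
      · nlinarith [sq_nonneg (u x y - c - pd2 u x y)]
    have h2 : ∫ x in (0:ℝ)..(2 * π), ((u x y - c) ^ 2 + (pd2 u x y) ^ 2) =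
        (∫ x in (0:ℝ)..(2 * π), (u x y - c) ^ 2) + ∫ x in (0:ℝ)..(2 * π), (pd2 u x y) ^ 2 :=
      intervalIntegral.integral_add ((cw.pow 2).intervalIntegrable _ _)
        ((s2.pow 2).intervalIntegrable _ _)
    rw [h2] at h1
    have := hW y hy
    simp only [hu.gradInt hy]
    linarith
  · intro y hy
    have hy : 0 < y := hy
    have e : (fun y => ∫ x in (0:ℝ)..(2 * π), gradSq u x y) =ᶠ[nhds y]
        fun y => (∫ x in (0:ℝ)..(2 * π), (pd1 u x y) ^ 2) +
          ∫ x in (0:ℝ)..(2 * π), (pd2 u x y) ^ 2 := by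
      filter_upwards [Ioi_mem_nhds hy] with z hz using hu.gradInt hz
    have d1 := hasDerivAt_param (f := fun x y => (pd1 u x y) ^ 2)
      (f' := fun x y => 2 * pd1 u x y * pd2 (pd1 u) x y) (hu.c1.pow 2)
      ((continuousOn_const.mul hu.c1).mul hu.c12)
      (fun x y hy => ((hp_deriv2 hu.smooth_pd1 x hy).pow 2).congr_deriv (by norm_num)) hy
    have d2 := hasDerivAt_param (f := fun x y => (pd2 u x y) ^ 2)
      (f' := fun x y => 2 * pd2 u x y * pd2 (pd2 u) x y) (hu.c2.pow 2)
      ((continuousOn_const.mul hu.c2).mul hu.c22)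
      (fun x y hy => ((hp_deriv2 hu.smooth_pd2 x hy).pow 2).congr_deriv (by norm_num)) hy
    exact ((d1.continuousAt.add d2.continuousAt).congr e.symm).continuousWithinAt

end UpperHarmonic

/-- Weighted exponential-decay estimate (Proposition A.4): for every `α ∈ (0,2)`,
`∫ |u − ū|² e^{α y₂} ≤ (1/(2−α)) ∫ |∇u|²` over one period of the upper half plane. -/
theorem weighted_exponential_decay
    (u : ℝ → ℝ → ℝ) (hu : UpperHarmonic u) :
    ∀ α : ℝ, 0 < α → α < 2 →
      (∫ p in Ioo (0 : ℝ) (2 * π) ×ˢ Ioi (0 : ℝ),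
          (u p.1 p.2 - interfaceAvg u) ^ 2 * Real.exp (α * p.2))
        ≤ (1 / (2 - α)) *
          ∫ p in Ioo (0 : ℝ) (2 * π) ×ˢ Ioi (0 : ℝ), gradSq u p.1 p.2 := by
  intro α hα0 hα2
  obtain ⟨h1, h2⟩ := hu.main_aux
  have hpos : 0 < 2 - α := by linarith
  have hRHS := UpperHarmonic.fubini hu.energy
  simp only at hRHS
  rw [hRHS]
  set F0 := ∫ x in (0:ℝ)..(2 * π), (u x 0 - interfaceAvg u) ^ 2 with hF0
  have hF0n : 0 ≤ F0 := UpperHarmonic.sq_int_nonneg _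
  refine le_trans ?_ (mul_le_mul_of_nonneg_left h2 (by positivity))
  by_cases hint : IntegrableOn (fun p : ℝ × ℝ =>
      (u p.1 p.2 - interfaceAvg u) ^ 2 * Real.exp (α * p.2)) (Ioo 0 (2 * π) ×ˢ Ioi 0)
  · rw [UpperHarmonic.fubini hint]
    have hneg : α - 2 < 0 := by linarith
    calc ∫ y in Ioi (0:ℝ), ∫ x in (0:ℝ)..(2 * π),
          (u x y - interfaceAvg u) ^ 2 * Real.exp (α * y)
        ≤ ∫ y in Ioi (0:ℝ), F0 * Real.exp ((α - 2) * y) := by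
          refine integral_mono_of_nonneg ?_ ((integrableOn_exp_mul_Ioi hneg 0).const_mul F0) ?_
          · refine Filter.Eventually.of_forall fun y => ?_
            exact intervalIntegral.integral_nonneg (by positivity) fun x _ => by positivity
          · filter_upwards [ae_restrict_mem measurableSet_Ioi] with y hy
            rw [intervalIntegral.integral_mul_const]
            refine (mul_le_mul_of_nonneg_right (h1 y hy) (Real.exp_pos _).le).trans (le_of_eq ?_)
            rw [mul_assoc, ← Real.exp_add]
            congr 2
            ring
      _ = 1 / (2 - α) * F0 := by
          rw [integral_const_mul, integral_exp_mul_Ioi hneg]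
          have : α - 2 ≠ 0 := hneg.ne
          have : 2 - α ≠ 0 := hpos.ne'
          rw [mul_zero, Real.exp_zero, show α - 2 = -(2 - α) by ring, neg_div_neg_eq]
          ring
  · rw [integral_undef hint]
    positivity

end
end

section
/- There exists a constant K > 0 (depending on u) such that for every y₂ ≥ 1 and every y₁ ∈ ℝ, |u(y₁,y₂) − ū| ≤ K e^{−y₂}; i.e. u converges to its interface average exponentially fast, uniformly in the horizontal variable. -/
open MeasureTheory Real Set

noncomputable section

lemma aux_differentiable_pt {g : ℂ → ℂ} (hg : DifferentiableOn ℂ g {z | 0 < z.im}) {y : ℝ}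
    (hy : 0 < y) : Continuous (fun x : ℝ => g (x + y * Complex.I)) := by
  have h : Continuous (fun x : ℝ => (x : ℂ) + y * Complex.I) := by fun_prop
  exact hg.continuousOn.comp_continuous h (fun x => by simp [hy])

/-- The modified Fourier coefficient does not depend on the height. -/
lemma aux_coeff_const {g : ℂ → ℂ} (hg : DifferentiableOn ℂ g {z | 0 < z.im})
    (hper : ∀ z, g (z + 2 * π) = g z) (k : ℤ) {a b : ℝ} (ha : 0 < a) (hb : 0 < b) :
    (∫ x in (0 : ℝ)..(2 * π), g (x + a * Complex.I) *
        Complex.exp (-(k * Complex.I * (x + a * Complex.I)))) =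
    ∫ x in (0 : ℝ)..(2 * π), g (x + b * Complex.I) *
        Complex.exp (-(k * Complex.I * (x + b * Complex.I))) := by
  have H := Complex.integral_boundary_rect_eq_zero_of_differentiableOn
    (fun z => g z * Complex.exp (-(k * Complex.I * z))) (⟨0, a⟩ : ℂ) (⟨2 * π, b⟩ : ℂ) ?_
  · simp only at H
    have e : ∀ y : ℝ, g (((2 * π : ℝ) : ℂ) + y * Complex.I) *
        Complex.exp (-(k * Complex.I * (((2 * π : ℝ) : ℂ) + y * Complex.I))) =
        g (((0 : ℝ) : ℂ) + y * Complex.I) *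
        Complex.exp (-(k * Complex.I * (((0 : ℝ) : ℂ) + y * Complex.I))) := by
      intro y
      congr 1
      · rw [← hper (((0 : ℝ) : ℂ) + y * Complex.I)]
        congr 1
        push_cast
        ring
      · rw [Complex.exp_eq_exp_iff_exists_int]
        refine ⟨-k, ?_⟩
        push_cast
        ring
    simp_rw [e] at H
    rw [add_sub_cancel_right] at H
    exact sub_eq_zero.1 H
  · apply DifferentiableOn.mul
    · refine hg.mono ?_
      intro z hz
      have := hz.2
      simp only [mem_preimage] at this
      have h2 := this.1
      have : 0 < min a b := lt_min ha hb
      exact lt_of_lt_of_le this h2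
    · fun_prop

lemma aux_cauchy_schwarz {h : ℝ → ℝ} (hh : Continuous h) :
    (∫ x in (0 : ℝ)..(2 * π), h x) ^ 2 ≤ 2 * π * ∫ x in (0 : ℝ)..(2 * π), h x ^ 2 := by
  set A := ∫ x in (0 : ℝ)..(2 * π), h x
  set B := ∫ x in (0 : ℝ)..(2 * π), h x ^ 2
  have h0 : 0 ≤ ∫ x in (0 : ℝ)..(2 * π), (2 * π * h x - A) ^ 2 :=
    intervalIntegral.integral_nonneg (by positivity) (fun x _ => sq_nonneg _)
  have e : (∫ x in (0 : ℝ)..(2 * π), (2 * π * h x - A) ^ 2) =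
      (2 * π) ^ 2 * B - 2 * (2 * π) * A * A + 2 * π * A ^ 2 := by
    have : ∀ x, (2 * π * h x - A) ^ 2 = (2 * π) ^ 2 * h x ^ 2 - 2 * (2 * π) * A * h x + A ^ 2 := by
      intro x; ring
    simp_rw [this]
    rw [intervalIntegral.integral_add, intervalIntegral.integral_sub,
      intervalIntegral.integral_const_mul, intervalIntegral.integral_const_mul,
      intervalIntegral.integral_const]
    · simp only [smul_eq_mul]; ring
    all_goals exact Continuous.intervalIntegrable (by fun_prop) _ _
  rw [e] at h0
  have hp : 0 < 2 * π := by positivity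
  have : 0 ≤ (2 * π) * (2 * π * B - A ^ 2) := by nlinarith
  have := nonneg_of_mul_nonneg_right this hp
  linarith

lemma aux_norm_exp (k : ℤ) (x y : ℝ) :
    ‖Complex.exp (-(k * Complex.I * (x + y * Complex.I)))‖ = Real.exp (k * y) := by
  rw [Complex.norm_exp]
  simp

lemma aux_coeff_le (g : ℂ → ℂ) (k : ℤ) (y : ℝ) :
    ‖∫ x in (0 : ℝ)..(2 * π), g (x + y * Complex.I) *
        Complex.exp (-(k * Complex.I * (x + y * Complex.I)))‖ ≤
      Real.exp (k * y) * ∫ x in (0 : ℝ)..(2 * π), ‖g (x + y * Complex.I)‖ := by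
  refine (intervalIntegral.norm_integral_le_integral_norm (by positivity)).trans ?_
  rw [← intervalIntegral.integral_const_mul]
  apply le_of_eq
  congr 1
  ext x
  rw [norm_mul, aux_norm_exp, mul_comm]

lemma aux_coeff_zero {g : ℂ → ℂ} (hg : DifferentiableOn ℂ g {z | 0 < z.im})
    (hper : ∀ z, g (z + 2 * π) = g z)
    (hint : IntegrableOn (fun p : ℝ × ℝ => ‖g (p.1 + p.2 * Complex.I)‖ ^ 2)
      (Ioo 0 (2 * π) ×ˢ Ioi 0)) (k : ℤ) (hk : k ≤ 0) {y : ℝ} (hy : 0 < y) :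
    (∫ x in (0 : ℝ)..(2 * π), g (x + y * Complex.I) *
        Complex.exp (-(k * Complex.I * (x + y * Complex.I)))) = 0 := by
  set c := ∫ x in (0 : ℝ)..(2 * π), g (x + y * Complex.I) *
        Complex.exp (-(k * Complex.I * (x + y * Complex.I))) with hc
  have hE : IntegrableOn (fun t : ℝ => ∫ x in Ioo 0 (2 * π), ‖g (x + t * Complex.I)‖ ^ 2)
      (Ioi 0) := by
    rw [IntegrableOn, Measure.volume_eq_prod, ← Measure.prod_restrict] at hint
    exact hint.integral_prod_right
  have hle : ∀ t ∈ Ioi (0 : ℝ), ‖c‖ ^ 2 ≤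
      2 * π * ∫ x in Ioo 0 (2 * π), ‖g (x + t * Complex.I)‖ ^ 2 := by
    intro t ht
    have ht : 0 < t := ht
    have h1 := aux_coeff_le g k t
    rw [← aux_coeff_const hg hper k hy ht, ← hc] at h1
    have h2 := aux_cauchy_schwarz (h := fun x => ‖g (x + t * Complex.I)‖)
      (aux_differentiable_pt hg ht).norm
    rw [intervalIntegral.integral_of_le (by positivity : (0:ℝ) ≤ 2 * π) (f := fun x : ℝ => ‖g (x + t * Complex.I)‖ ^ 2),
      integral_Ioc_eq_integral_Ioo] at h2
    refine le_trans ?_ h2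
    have h3 : 0 ≤ ∫ x in (0 : ℝ)..(2 * π), ‖g (x + t * Complex.I)‖ :=
      intervalIntegral.integral_nonneg (by positivity) (fun x _ => norm_nonneg _)
    have h4 : Real.exp (k * t) ≤ 1 := by
      rw [Real.exp_le_one_iff]
      have : (k : ℝ) ≤ 0 := by exact_mod_cast hk
      nlinarith
    gcongr
    exact h1.trans (mul_le_of_le_one_left h3 h4)
  have hci : IntegrableOn (fun _ : ℝ => ‖c‖ ^ 2) (Ioi 0) := by
    refine Integrable.mono' (hE.const_mul (2 * π)) (by fun_prop) ?_
    filter_upwards [ae_restrict_mem measurableSet_Ioi] with t ht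
    rw [Real.norm_of_nonneg (by positivity)]
    exact hle t ht
  rw [integrableOn_const_iff] at hci
  simpa using hci

lemma aux_decay {g : ℂ → ℂ} (hg : DifferentiableOn ℂ g {z | 0 < z.im})
    (hper : ∀ z, g (z + 2 * π) = g z)
    (hint : IntegrableOn (fun p : ℝ × ℝ => ‖g (p.1 + p.2 * Complex.I)‖ ^ 2)
      (Ioo 0 (2 * π) ×ˢ Ioi 0)) :
    ∃ C > 0, ∀ y : ℝ, 1 ≤ y → ∀ x : ℝ, ‖g (x + y * Complex.I)‖ ≤ C * Real.exp (-y) := by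
  have : Fact (0 < 2 * π) := ⟨by positivity⟩
  set M := ∫ x in (0 : ℝ)..(2 * π), ‖g (x + (1 / 2 : ℝ) * Complex.I)‖ with hM
  have hM0 : 0 ≤ M := intervalIntegral.integral_nonneg (by positivity) (fun x _ => norm_nonneg _)
  have hr : Summable (fun n : ℕ => Real.exp (-(1 / 2 : ℝ)) ^ n) :=
    summable_geometric_of_lt_one (by positivity) (by rw [Real.exp_lt_one_iff]; norm_num)
  set S := ∑' n : ℕ, Real.exp (-(1 / 2 : ℝ)) ^ n with hS
  have hS0 : 0 ≤ S := tsum_nonneg (fun n => by positivity)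
  refine ⟨M * S * Real.exp (1 / 2) + 1, by positivity, ?_⟩
  intro y hy x
  have hy0 : 0 < y := by linarith
  have hp : Function.Periodic (fun x : ℝ => g (x + y * Complex.I)) (2 * π) := by
    intro x
    simp only
    rw [← hper (x + y * Complex.I)]
    congr 1
    push_cast
    ring
  let F : C(AddCircle (2 * π), ℂ) :=
    ⟨hp.lift, continuous_coinduced_dom.mpr (aux_differentiable_pt hg hy0)⟩
  have hF : ∀ x : ℝ, F (x : AddCircle (2 * π)) = g (x + y * Complex.I) := fun x => rfl
  have hco : ∀ k : ℤ, fourierCoeff F k = (1 / (2 * π) * Real.exp (-(k * y)) : ℝ) *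
      ∫ x in (0 : ℝ)..(2 * π), g (x + y * Complex.I) *
        Complex.exp (-(k * Complex.I * (x + y * Complex.I))) := by
    intro k
    rw [fourierCoeff_eq_intervalIntegral _ _ 0, zero_add, Complex.ofReal_mul, mul_assoc,
      ← intervalIntegral.integral_const_mul, Complex.real_smul]
    congr 1
    apply intervalIntegral.integral_congr
    intro x _
    simp only [fourier_coe_apply, hF, smul_eq_mul]
    rw [mul_comm, mul_left_comm, Complex.ofReal_exp, ← Complex.exp_add]
    congr 2
    have : (π : ℂ) ≠ 0 := by exact_mod_cast Real.pi_ne_zero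
    push_cast
    field_simp
    ring_nf
    simp only [Complex.I_sq]
    ring
  have hneg : ∀ k : ℤ, k ≤ 0 → fourierCoeff F k = 0 := by
    intro k hk
    rw [hco, aux_coeff_zero hg hper hint k hk hy0, mul_zero]
  have hpos : ∀ n : ℕ, ‖fourierCoeff F ((n : ℤ) + 1)‖ ≤
      M * Real.exp (1 / 2) * Real.exp (-y) * Real.exp (-(1 / 2 : ℝ)) ^ n := by
    intro n
    rw [hco, aux_coeff_const hg hper _ hy0 (by norm_num : (0 : ℝ) < 1 / 2), norm_mul,
      Complex.norm_real, Real.norm_of_nonneg (by positivity)]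
    have h1 := aux_coeff_le g ((n : ℤ) + 1) (1 / 2)
    rw [← hM] at h1
    have h2 : 1 / (2 * π) ≤ 1 := by
      rw [div_le_one (by positivity)]
      linarith [Real.pi_gt_three]
    calc _ ≤ 1 * Real.exp (-(((n : ℤ) + 1 : ℤ) * y)) *
          (Real.exp (((n : ℤ) + 1 : ℤ) * (1 / 2)) * M) := by gcongr
      _ = M * Real.exp (-(((n : ℤ) + 1 : ℤ) * y) + ((n : ℤ) + 1 : ℤ) * (1 / 2)) := by
          rw [Real.exp_add]; ring
      _ ≤ M * Real.exp (1 / 2 + -y + n * (-(1 / 2))) := by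
          refine mul_le_mul_of_nonneg_left (Real.exp_le_exp.2 ?_) hM0
          push_cast
          have : (0 : ℝ) ≤ n := by positivity
          nlinarith
      _ = _ := by rw [Real.exp_add, Real.exp_add, Real.exp_nat_mul]; ring
  have hinj : Function.Injective (fun n : ℕ => (n : ℤ) + 1) := by
    intro a b h
    simp only at h
    omega
  have hsupp : ∀ k : ℤ, k ∉ Set.range (fun n : ℕ => (n : ℤ) + 1) → fourierCoeff F k = 0 := by
    intro k hk
    apply hneg
    by_contra h
    push Not at h
    exact hk ⟨(k - 1).toNat, by simp only; omega⟩
  have hsum1 : Summable (fun n : ℕ => ‖fourierCoeff F ((n : ℤ) + 1)‖) :=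
    Summable.of_nonneg_of_le (fun _ => norm_nonneg _) hpos (hr.mul_left _)
  have hsum : Summable (fourierCoeff F) := by
    rw [← hinj.summable_iff hsupp]
    exact hsum1.of_norm
  have hs := has_pointwise_sum_fourier_series_of_summable hsum (x : AddCircle (2 * π))
  rw [hF] at hs
  rw [← hinj.hasSum_iff (fun k hk => by rw [hsupp k hk, zero_smul])] at hs
  have hn := hs.norm_le_of_bounded (hr.mul_left (M * Real.exp (1 / 2) * Real.exp (-y))).hasSum
    (fun n => by
      simp only [Function.comp, norm_smul]
      have : ‖(fourier ((n : ℤ) + 1) (x : AddCircle (2 * π)) : ℂ)‖ = 1 := by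
        rw [fourier_apply]; exact Circle.norm_coe _
      rw [this, mul_one]
      exact hpos n)
  rw [tsum_mul_left, ← hS] at hn
  refine hn.trans ?_
  have := Real.exp_pos (-y)
  nlinarith

def auxF (u : ℝ → ℝ → ℝ) (z : ℂ) : ℝ := u z.re z.im

def auxG (u : ℝ → ℝ → ℝ) (z : ℂ) : ℂ :=
  fderiv ℝ (auxF u) z 1 - Complex.I * fderiv ℝ (auxF u) z Complex.I

lemma aux_open : IsOpen {z : ℂ | 0 < z.im} := isOpen_lt continuous_const Complex.continuous_im

lemma auxF_contDiffAt {u : ℝ → ℝ → ℝ} (hu : UpperHarmonic u) {z : ℂ} (hz : 0 < z.im) :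
    ContDiffAt ℝ 2 (auxF u) z := by
  have h1 : ContDiffOn ℝ 2 (auxF u) {z : ℂ | 0 < z.im} := by
    refine hu.smooth.comp (f := fun z : ℂ => (z.re, z.im)) (ContDiff.contDiffOn ?_)
      (fun z hz => hz)
    exact (Complex.reCLM.contDiff).prodMk (Complex.imCLM.contDiff)
  exact h1.contDiffAt (aux_open.mem_nhds hz)

lemma aux_line1 (x y : ℝ) : HasDerivAt (fun t : ℝ => (t : ℂ) + y * Complex.I) 1 x :=
  (Complex.ofRealCLM.hasDerivAt (x := x)).add_const _

lemma aux_line2 (x y : ℝ) : HasDerivAt (fun t : ℝ => (x : ℂ) + t * Complex.I) Complex.I y := by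
  have := ((Complex.ofRealCLM.hasDerivAt (x := y)).mul_const Complex.I).const_add (x : ℂ)
  simpa using this

lemma aux_hasDerivAt1 {u : ℝ → ℝ → ℝ} (hu : UpperHarmonic u) (x : ℝ) {y : ℝ} (hy : 0 < y) :
    HasDerivAt (fun t => u t y) (fderiv ℝ (auxF u) (x + y * Complex.I) 1) x := by
  have h := ((auxF_contDiffAt hu (z := x + y * Complex.I) (by simp [hy])).differentiableAt
    (by norm_num)).hasFDerivAt
  have := h.comp_hasDerivAt x (aux_line1 x y)
  refine this.congr_of_eventuallyEq (Filter.Eventually.of_forall fun t => ?_)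
  simp [auxF]

lemma aux_hasDerivAt2 {u : ℝ → ℝ → ℝ} (hu : UpperHarmonic u) (x : ℝ) {y : ℝ} (hy : 0 < y) :
    HasDerivAt (fun t => u x t) (fderiv ℝ (auxF u) (x + y * Complex.I) Complex.I) y := by
  have h := ((auxF_contDiffAt hu (z := x + y * Complex.I) (by simp [hy])).differentiableAt
    (by norm_num)).hasFDerivAt
  have := h.comp_hasDerivAt y (aux_line2 x y)
  refine this.congr_of_eventuallyEq (Filter.Eventually.of_forall fun t => ?_)
  simp [auxF]

lemma aux_pd1 {u : ℝ → ℝ → ℝ} (hu : UpperHarmonic u) (x : ℝ) {y : ℝ} (hy : 0 < y) :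
    pd1 u x y = fderiv ℝ (auxF u) (x + y * Complex.I) 1 := (aux_hasDerivAt1 hu x hy).deriv

lemma aux_pd2 {u : ℝ → ℝ → ℝ} (hu : UpperHarmonic u) (x : ℝ) {y : ℝ} (hy : 0 < y) :
    pd2 u x y = fderiv ℝ (auxF u) (x + y * Complex.I) Complex.I := (aux_hasDerivAt2 hu x hy).deriv

lemma aux_fd {u : ℝ → ℝ → ℝ} (hu : UpperHarmonic u) {z : ℂ} (hz : 0 < z.im) (v : ℂ) :
    HasFDerivAt (fun w => fderiv ℝ (auxF u) w v)
      ((fderiv ℝ (fderiv ℝ (auxF u)) z).flip v) z := by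
  have h : DifferentiableAt ℝ (fderiv ℝ (auxF u)) z :=
    ((auxF_contDiffAt hu hz).fderiv_right (m := 1) (by norm_num)).differentiableAt (by norm_num)
  have h2 := h.hasFDerivAt.clm_apply (hasFDerivAt_const v z)
  simpa using h2

lemma aux_laplacian {u : ℝ → ℝ → ℝ} (hu : UpperHarmonic u) {z : ℂ} (hz : 0 < z.im) :
    Laplacian.laplacian (auxF u) z = 0 := by
  rw [InnerProductSpace.laplacian_eq_iteratedFDeriv_complexPlane]
  simp only [iteratedFDeriv_two_apply, Matrix.cons_val_zero, Matrix.cons_val_one]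
  have h := hu.harmonic (z.re, z.im) hz
  have hz' : (z.re : ℂ) + z.im * Complex.I = z := Complex.re_add_im z
  have e1 : pd1 (pd1 u) z.re z.im = fderiv ℝ (fderiv ℝ (auxF u)) z 1 1 := by
    have hf := aux_fd hu hz 1
    rw [← hz'] at hf
    have := hf.comp_hasDerivAt z.re (aux_line1 z.re z.im)
    rw [hz'] at this
    refine (this.congr_of_eventuallyEq (Filter.Eventually.of_forall fun t => ?_)).deriv
    exact aux_pd1 hu t hz
  have e2 : pd2 (pd2 u) z.re z.im = fderiv ℝ (fderiv ℝ (auxF u)) z Complex.I Complex.I := by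
    have hf := aux_fd hu hz Complex.I
    rw [← hz'] at hf
    have := hf.comp_hasDerivAt z.im (aux_line2 z.re z.im)
    rw [hz'] at this
    refine (this.congr_of_eventuallyEq ?_).deriv
    filter_upwards [lt_mem_nhds hz] with t ht
    exact aux_pd2 hu z.re ht
  rw [← e1, ← e2]
  exact h

lemma auxG_diff {u : ℝ → ℝ → ℝ} (hu : UpperHarmonic u) :
    DifferentiableOn ℂ (auxG u) {z | 0 < z.im} := by
  intro z hz
  have : InnerProductSpace.HarmonicAt (auxF u) z := by
    refine ⟨auxF_contDiffAt hu hz, ?_⟩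
    filter_upwards [aux_open.mem_nhds hz] with w hw
    exact aux_laplacian hu hw
  exact (HarmonicAt.differentiableAt_complex_partial this).differentiableWithinAt

lemma auxG_per {u : ℝ → ℝ → ℝ} (hu : UpperHarmonic u) (z : ℂ) :
    auxG u (z + 2 * π) = auxG u z := by
  have h : (fun w => auxF u (w + 2 * π)) = auxF u := by
    ext w
    have := hu.periodic w.re w.im
    simpa [auxF] using this
  have h2 : fderiv ℝ (auxF u) (z + 2 * π) = fderiv ℝ (auxF u) z := by
    rw [← fderiv_comp_add_right, h]
  simp only [auxG, h2]

lemma auxG_re {u : ℝ → ℝ → ℝ} (z : ℂ) : (auxG u z).re = fderiv ℝ (auxF u) z 1 := by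
  simp [auxG]

lemma auxG_im {u : ℝ → ℝ → ℝ} (z : ℂ) : (auxG u z).im = - fderiv ℝ (auxF u) z Complex.I := by
  simp [auxG]

lemma auxG_int {u : ℝ → ℝ → ℝ} (hu : UpperHarmonic u) :
    IntegrableOn (fun p : ℝ × ℝ => ‖auxG u (p.1 + p.2 * Complex.I)‖ ^ 2)
      (Ioo 0 (2 * π) ×ˢ Ioi 0) := by
  refine hu.energy.congr_fun ?_ (measurableSet_Ioo.prod measurableSet_Ioi)
  rintro ⟨x, y⟩ ⟨_, hy⟩
  simp only [gradSq]
  rw [aux_pd1 hu x hy, aux_pd2 hu x hy, ← Complex.normSq_eq_norm_sq, Complex.normSq_apply,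
    auxG_re, auxG_im]
  ring

lemma aux_mean_const {u : ℝ → ℝ → ℝ} (hu : UpperHarmonic u) {a b : ℝ} (ha : 0 < a) (hab : a ≤ b) :
    (∫ x in (0 : ℝ)..(2 * π), u x a) = ∫ x in (0 : ℝ)..(2 * π), u x b := by
  have hc : ContinuousOn (fun p : ℝ × ℝ => (auxG u (p.1 + p.2 * Complex.I)).im)
      {p : ℝ × ℝ | 0 < p.2} := by
    refine Complex.continuous_im.comp_continuousOn ((auxG_diff hu).continuousOn.comp
      (f := fun p : ℝ × ℝ => (p.1 : ℂ) + p.2 * Complex.I) (by fun_prop) ?_)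
    intro p hp
    simpa using hp
  have hcu : ∀ y : ℝ, 0 < y → Continuous (fun x => u x y) := fun y hy =>
    continuous_iff_continuousAt.2 fun x => (aux_hasDerivAt1 hu x hy).continuousAt
  have hz : ∀ y : ℝ, 0 < y →
      (∫ x in (0 : ℝ)..(2 * π), (auxG u (x + y * Complex.I)).im) = 0 := by
    intro y hy
    have h0 := aux_coeff_zero (auxG_diff hu) (auxG_per hu) (auxG_int hu) 0 le_rfl hy
    simp only [Int.cast_zero, zero_mul, neg_zero, Complex.exp_zero, mul_one] at h0
    have := Complex.imCLM.intervalIntegral_comp_comm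
      ((aux_differentiable_pt (auxG_diff hu) hy).intervalIntegrable (μ := volume) 0 (2 * π))
    rw [h0] at this
    simpa using this
  have hftc : ∀ x : ℝ, (∫ y in a..b, (auxG u (x + y * Complex.I)).im) = u x a - u x b := by
    intro x
    have hd : ∀ y ∈ uIcc a b, HasDerivAt (fun t => - u x t) (auxG u (x + y * Complex.I)).im y := by
      intro y hy
      rw [uIcc_of_le hab] at hy
      rw [auxG_im]
      exact (aux_hasDerivAt2 hu x (ha.trans_le hy.1)).neg
    rw [intervalIntegral.integral_eq_sub_of_hasDerivAt hd]
    · ring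
    · apply ContinuousOn.intervalIntegrable
      refine hc.comp (f := fun y : ℝ => (x, y)) (by fun_prop) ?_
      intro y hy
      rw [uIcc_of_le hab] at hy
      exact ha.trans_le hy.1
  have hsw := intervalIntegral_intervalIntegral_swap (a := 0) (b := 2 * π) (c := a) (d := b)
    (F := fun x y : ℝ => (auxG u (x + y * Complex.I)).im) (by
      have hk : IntegrableOn (fun p : ℝ × ℝ => (auxG u (p.1 + p.2 * Complex.I)).im)
          (uIcc 0 (2 * π) ×ˢ uIcc a b) := by
        refine ContinuousOn.integrableOn_compact (isCompact_uIcc.prod isCompact_uIcc)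
          (hc.mono ?_)
        rintro ⟨x, y⟩ ⟨_, hy⟩
        rw [uIcc_of_le hab] at hy
        exact ha.trans_le hy.1
      exact hk.mono_set (prod_mono uIoc_subset_uIcc uIoc_subset_uIcc))
  simp_rw [hftc] at hsw
  have hr : (∫ y in a..b, ∫ x in (0 : ℝ)..(2 * π), (auxG u (x + y * Complex.I)).im) = 0 := by
    rw [intervalIntegral.integral_congr (g := fun _ => (0 : ℝ))]
    · simp
    · intro y hy
      rw [uIcc_of_le hab] at hy
      exact hz y (ha.trans_le hy.1)
  rw [hr, intervalIntegral.integral_sub ((hcu a ha).intervalIntegrable _ _)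
    ((hcu b (ha.trans_le hab)).intervalIntegrable _ _)] at hsw
  linarith

lemma aux_mean_zero {u : ℝ → ℝ → ℝ} (hu : UpperHarmonic u) {b : ℝ} (hb : 0 < b) :
    (∫ x in (0 : ℝ)..(2 * π), u x 0) = ∫ x in (0 : ℝ)..(2 * π), u x b := by
  have hc : Continuous (fun y : ℝ => ∫ x in (0 : ℝ)..(2 * π), u x (max y 0)) := by
    apply intervalIntegral.continuous_parametric_intervalIntegral_of_continuous'
      (f := fun y x : ℝ => u x (max y 0))
    exact hu.cont.comp_continuous (f := fun p : ℝ × ℝ => (p.2, max p.1 0)) (by fun_prop)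
      (fun p => by simp)
  have h1 : Filter.Tendsto (fun y : ℝ => ∫ x in (0 : ℝ)..(2 * π), u x (max y 0))
      (nhdsWithin 0 (Ioi 0)) (nhds (∫ x in (0 : ℝ)..(2 * π), u x 0)) := by
    have := hc.tendsto 0
    simp only [max_self] at this
    exact this.mono_left nhdsWithin_le_nhds
  have h2 : Filter.Tendsto (fun y : ℝ => ∫ x in (0 : ℝ)..(2 * π), u x (max y 0))
      (nhdsWithin 0 (Ioi 0)) (nhds (∫ x in (0 : ℝ)..(2 * π), u x b)) := by
    refine tendsto_const_nhds.congr' ?_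
    filter_upwards [Ioo_mem_nhdsGT hb] with y hy
    rw [max_eq_left hy.1.le]
    exact (aux_mean_const hu hy.1 hy.2.le).symm
  exact tendsto_nhds_unique h1 h2

/-- Pointwise exponential convergence to the interface average: there is `K > 0`
(depending on `u`) with `|u(y₁,y₂) − ū| ≤ K e^{−y₂}` for all `y₂ ≥ 1`, uniformly in `y₁`. -/
theorem pointwise_exponential_decay
    (u : ℝ → ℝ → ℝ) (hu : UpperHarmonic u) :
    ∃ K > (0 : ℝ), ∀ y₂ : ℝ, 1 ≤ y₂ → ∀ y₁ : ℝ,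
      |u y₁ y₂ - interfaceAvg u| ≤ K * Real.exp (-y₂) := by
  obtain ⟨C, hC, hdec⟩ := aux_decay (auxG_diff hu) (auxG_per hu) (auxG_int hu)
  refine ⟨C * (2 * π), by positivity, ?_⟩
  intro y hy x₀
  have hy0 : 0 < y := by linarith
  have hper : Function.Periodic (fun x => u x y) (2 * π) := fun x => hu.periodic x y
  obtain ⟨x, hx, hxe⟩ := hper.exists_mem_Ico₀ (by positivity) x₀
  rw [hxe]
  have hcu : Continuous (fun x => u x y) :=
    continuous_iff_continuousAt.2 fun x => (aux_hasDerivAt1 hu x hy0).continuousAt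
  have hlip : ∀ s t : ℝ, |u s y - u t y| ≤ C * Real.exp (-y) * |s - t| := by
    intro s t
    have := convex_univ.norm_image_sub_le_of_norm_hasDerivWithin_le (𝕜 := ℝ)
      (f := fun x => u x y) (C := C * Real.exp (-y)) (x := t) (y := s)
      (fun x _ => (aux_hasDerivAt1 hu x hy0).hasDerivWithinAt) (fun x _ => by
        rw [← auxG_re]
        exact (Complex.abs_re_le_norm _).trans (hdec y hy x)) (mem_univ _) (mem_univ _)
    simpa [Real.norm_eq_abs] using this
  have hm : u x y - interfaceAvg u =
      (1 / (2 * π)) * ∫ t in (0 : ℝ)..(2 * π), (u x y - u t y) := by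
    rw [interfaceAvg, aux_mean_zero hu hy0, intervalIntegral.integral_sub
      (by simp) (hcu.intervalIntegrable _ _), intervalIntegral.integral_const]
    simp only [smul_eq_mul, sub_zero]
    field_simp
  have hI : |∫ t in (0 : ℝ)..(2 * π), (u x y - u t y)| ≤
      C * Real.exp (-y) * (2 * π) * |2 * π - 0| := by
    rw [← Real.norm_eq_abs]
    apply intervalIntegral.norm_integral_le_of_norm_le_const
    intro t ht
    rw [uIoc_of_le (by positivity)] at ht
    rw [Real.norm_eq_abs]
    refine (hlip x t).trans ?_
    gcongr
    rw [abs_le]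
    constructor <;> linarith [hx.1, hx.2, ht.1, ht.2]
  have hp : 0 < 2 * π := by positivity
  rw [hm, abs_mul, abs_of_pos (by positivity)]
  rw [sub_zero, abs_of_pos hp] at hI
  calc _ ≤ 1 / (2 * π) * (C * Real.exp (-y) * (2 * π) * (2 * π)) := by gcongr
    _ = _ := by field_simp

end
end

section
/- Normal-derivative elliptic estimate used in the very weak (duality) argument: there exists a constant c > 0 depending only on L such that for every function v of class C² on the closed strip [0,L]×[0,1] that is the restriction of an L-periodic-in-x₁ C² function and vanishes on both horizontal boundaries (v(x₁,0) = v(x₁,1) = 0 for all x₁), one has ∫₀^L |∂v/∂x₂(x₁,0)|² dx₁ ≤ c ∫_{(0,L)×(0,1)} |Δv|² dx. -/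
open MeasureTheory Real Set

noncomputable section

/-- One-sided normal derivative at the lower boundary `Γ⁰`, taken within the strip. -/
def normalDerivStrip (v : ℝ → ℝ → ℝ) (x : ℝ) : ℝ :=
  derivWithin (fun t => v x t) (Icc (0 : ℝ) 1) 0

namespace NDE

def S : Set (ℝ × ℝ) := (univ : Set ℝ) ×ˢ Icc (0 : ℝ) 1

lemma uds : UniqueDiffOn ℝ S := uniqueDiffOn_univ.prod (uniqueDiffOn_Icc zero_lt_one)

lemma S_nhds {p : ℝ × ℝ} (h : p.2 ∈ Ioo (0 : ℝ) 1) : S ∈ nhds p :=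
  prod_mem_nhds Filter.univ_mem (Icc_mem_nhds h.1 h.2)

/-- divergence theorem for `C¹` fields on the strip -/
lemma div_thm (L : ℝ) (hL : 0 < L) (P Q : ℝ × ℝ → ℝ) (hP : ContDiffOn ℝ 1 P S)
    (hQ : ContDiffOn ℝ 1 Q S) (hper : ∀ y ∈ Icc (0 : ℝ) 1, P (L, y) = P (0, y)) :
    IntegrableOn (fun p => fderivWithin ℝ P S p (1, 0) + fderivWithin ℝ Q S p (0, 1))
      (Omega0 L) ∧
    ∫ p in Omega0 L, (fderivWithin ℝ P S p (1, 0) + fderivWithin ℝ Q S p (0, 1)) =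
      (∫ x in (0 : ℝ)..L, Q (x, 1)) - ∫ x in (0 : ℝ)..L, Q (x, 0) := by
  have hsub : Icc ((0 : ℝ), (0 : ℝ)) (L, 1) ⊆ S := fun p hp =>
    ⟨trivial, hp.1.2, hp.2.2⟩
  have hcont : ContinuousOn
      (fun p => fderivWithin ℝ P S p (1, 0) + fderivWithin ℝ Q S p (0, 1)) S :=
    ((hP.continuousOn_fderivWithin uds le_rfl).clm_apply continuousOn_const).add
      ((hQ.continuousOn_fderivWithin uds le_rfl).clm_apply continuousOn_const)
  have hint : IntegrableOn
      (fun p => fderivWithin ℝ P S p (1, 0) + fderivWithin ℝ Q S p (0, 1))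
      (Icc ((0 : ℝ), (0 : ℝ)) (L, 1)) :=
    (hcont.mono hsub).integrableOn_compact isCompact_Icc
  have hae : Omega0 L =ᵐ[volume] Icc ((0 : ℝ), (0 : ℝ)) (L, 1) := by
    rw [← Icc_prod_Icc, Omega0]
    exact Measure.set_prod_ae_eq Ioo_ae_eq_Icc Ioo_ae_eq_Icc
  refine ⟨hint.congr_set_ae hae, ?_⟩
  rw [setIntegral_congr_set hae]
  have := integral_divergence_prod_Icc_of_hasFDerivAt_of_le P Q
    (fderivWithin ℝ P S) (fderivWithin ℝ Q S) ((0 : ℝ), (0 : ℝ)) (L, 1)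
    ⟨hL.le, zero_le_one⟩
    (hP.continuousOn.mono hsub)
    (hQ.continuousOn.mono hsub)
    (fun p hp => ((hP.differentiableOn one_ne_zero) p
      ⟨trivial, Ioo_subset_Icc_self hp.2⟩).hasFDerivWithinAt.hasFDerivAt (S_nhds hp.2))
    (fun p hp => ((hQ.differentiableOn one_ne_zero) p
      ⟨trivial, Ioo_subset_Icc_self hp.2⟩).hasFDerivWithinAt.hasFDerivAt (S_nhds hp.2))
    hint
  rw [this]
  have h2 : ∫ y in (0 : ℝ)..1, P (L, y) = ∫ y in (0 : ℝ)..1, P (0, y) := by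
    apply intervalIntegral.integral_congr
    intro y hy
    rw [uIcc_of_le zero_le_one] at hy
    exact hper y hy
  simp only [h2]
  ring

lemma pw (φ m a b u d : ℝ) (h1 : φ ^ 2 ≤ 1) (h2 : m ^ 2 ≤ 1) :
    -(2 * φ * b * d - (b ^ 2 - a ^ 2) + 4 * (a ^ 2 + b ^ 2 + u * d) + 2 * u ^ 2 + 2 * m * u * b)
      ≤ 5 * d ^ 2 := by
  have e1 : 0 ≤ (φ * b + d) ^ 2 := sq_nonneg _
  have e2 : 0 ≤ (u + m * b) ^ 2 := sq_nonneg _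
  have e3 : 0 ≤ (u + 2 * d) ^ 2 := sq_nonneg _
  have e4 : 0 ≤ (1 - φ ^ 2) * b ^ 2 := mul_nonneg (by linarith) (sq_nonneg _)
  have e5 : 0 ≤ (1 - m ^ 2) * b ^ 2 := mul_nonneg (by linarith) (sq_nonneg _)
  nlinarith [sq_nonneg a]

lemma main (L : ℝ) (hL : 0 < L) (v : ℝ → ℝ → ℝ)
    (hv : ContDiffOn ℝ 2 (fun p : ℝ × ℝ => v p.1 p.2) S)
    (hper : ∀ x y, v (x + L) y = v x y) (h0 : ∀ x, v x 0 = 0) (h1 : ∀ x, v x 1 = 0) :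
    (∫ t in (0 : ℝ)..L, (normalDerivStrip v t) ^ 2)
        ≤ 5 * ∫ p in Omega0 L, (lap v p.1 p.2) ^ 2 := by
  set u : ℝ × ℝ → ℝ := fun p => v p.1 p.2 with hu
  set D := fderivWithin ℝ u S with hD
  have hDc : ContDiffOn ℝ 1 D S := hv.fderivWithin uds (by norm_num)
  set a : ℝ × ℝ → ℝ := fun p => D p (1, 0) with ha
  set b : ℝ × ℝ → ℝ := fun p => D p (0, 1) with hb
  have hac : ContDiffOn ℝ 1 a S := hDc.clm_apply contDiffOn_const
  have hbc : ContDiffOn ℝ 1 b S := hDc.clm_apply contDiffOn_const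
  have huc : ContDiffOn ℝ 1 u S := hv.of_le (by norm_num)
  have hdu : ∀ p ∈ S, HasFDerivWithinAt u (D p) S p := fun p hp =>
    (huc.differentiableOn one_ne_zero p hp).hasFDerivWithinAt
  have hdx : ∀ x, ∀ y ∈ Icc (0 : ℝ) 1, HasDerivAt (fun t => v t y) (a (x, y)) x := by
    intro x y hy
    have h := (hdu (x, y) ⟨trivial, hy⟩).comp_hasDerivWithinAt (s := univ) (f := fun t : ℝ => (t, y)) x
      (((hasDerivAt_id x).prodMk (hasDerivAt_const x y)).hasDerivWithinAt)
      (fun t _ => ⟨trivial, hy⟩)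
    exact hasDerivWithinAt_univ.1 h
  have hdy : ∀ x, ∀ y ∈ Icc (0 : ℝ) 1,
      HasDerivWithinAt (fun t => v x t) (b (x, y)) (Icc 0 1) y := by
    intro x y hy
    exact (hdu (x, y) ⟨trivial, hy⟩).comp_hasDerivWithinAt (s := Icc 0 1) (f := fun t : ℝ => (x, t)) y
      (((hasDerivAt_const y x).prodMk (hasDerivAt_id y)).hasDerivWithinAt)
      (fun t ht => ⟨trivial, ht⟩)
  have hnd : ∀ x, normalDerivStrip v x = b (x, 0) := fun x =>
    (hdy x 0 ⟨le_rfl, zero_le_one⟩).derivWithin (uniqueDiffOn_Icc zero_lt_one 0 ⟨le_rfl, zero_le_one⟩)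
  have hva : ∀ y, v L y = v 0 y := fun y => by simpa using hper 0 y
  have hpa : ∀ y ∈ Icc (0 : ℝ) 1, a (L, y) = a (0, y) := by
    intro y hy
    have e1 : HasDerivAt (fun t => v (t + L) y) (a (L, y)) 0 := by
      apply HasDerivAt.comp_add_const (f := fun t => v t y)
      simpa using hdx L y hy
    simp only [hper] at e1
    exact e1.unique (hdx 0 y hy)
  have hpb : ∀ y ∈ Icc (0 : ℝ) 1, b (L, y) = b (0, y) := by
    intro y hy
    have e1 := hdy L y hy
    simp only [hva] at e1
    exact (uniqueDiffOn_Icc zero_lt_one y hy).eq_deriv _ e1 (hdy 0 y hy)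
  have ha0 : ∀ x, a (x, 0) = 0 := by
    intro x
    have e1 := hdx x 0 ⟨le_rfl, zero_le_one⟩
    simp only [h0] at e1
    exact e1.unique (hasDerivAt_const x 0)
  have hint : ∀ p : ℝ × ℝ, p.2 ∈ Ioo (0 : ℝ) 1 → ∀ᶠ q in nhds p, q.2 ∈ Ioo (0 : ℝ) 1 := by
    intro p hp
    exact continuous_snd.continuousAt.eventually (isOpen_Ioo.mem_nhds hp)
  set P : ℝ × ℝ → ℝ := fun p => 2 * (1 - p.2) * a p * b p + 4 * u p * a p with hP
  set Q : ℝ × ℝ → ℝ := fun p => (1 - p.2) * (b p ^ 2 - a p ^ 2) + 4 * u p * b p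
    + (2 * p.2 - 1) * u p ^ 2 with hQ
  have hsnd : ContDiffOn ℝ 1 (fun p : ℝ × ℝ => p.2) S := contDiffOn_snd
  have hPc : ContDiffOn ℝ 1 P S := by
    simp only [hP]
    fun_prop
  have hQc : ContDiffOn ℝ 1 Q S := by
    simp only [hQ]
    fun_prop
  obtain ⟨hI, hE⟩ := div_thm L hL P Q hPc hQc (by
    intro y hy
    simp only [hP, hpa y hy, hpb y hy, hu, hva])
  have hbd : (∫ x in (0 : ℝ)..L, Q (x, 1)) - (∫ x in (0 : ℝ)..L, Q (x, 0)) =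
      - ∫ t in (0 : ℝ)..L, (normalDerivStrip v t) ^ 2 := by
    simp [hQ, hu, h0, h1, hnd, ha0]
  set DD := fderivWithin ℝ D S with hDD
  have hDDc : ContinuousOn DD S := hDc.continuousOn_fderivWithin uds le_rfl
  have hlap : ∀ p : ℝ × ℝ, p.2 ∈ Ioo (0 : ℝ) 1 →
      lap v p.1 p.2 = DD p (1, 0) (1, 0) + DD p (0, 1) (0, 1) := by
    rintro ⟨x, y⟩ hp
    have hy : y ∈ Icc (0 : ℝ) 1 := Ioo_subset_Icc_self hp
    have hDf : HasFDerivAt D (DD (x, y)) (x, y) :=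
      (hDc.differentiableOn one_ne_zero (x, y) ⟨trivial, hy⟩).hasFDerivWithinAt.hasFDerivAt
        (S_nhds hp)
    have e1 : pd1 (pd1 v) x y = DD (x, y) (1, 0) (1, 0) := by
      have : (fun t => pd1 v t y) = fun t => D (t, y) (1, 0) := by
        funext t
        exact (hdx t y hy).deriv
      rw [pd1, this]
      have h := hDf.comp_hasDerivAt (f := fun t : ℝ => (t, y)) x
        ((hasDerivAt_id x).prodMk (hasDerivAt_const x y))
      have h' := h.clm_apply (hasDerivAt_const x ((1 : ℝ), (0 : ℝ)))
      simpa using h'.deriv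
    have e2 : pd2 (pd2 v) x y = DD (x, y) (0, 1) (0, 1) := by
      have : (fun t => pd2 v x t) =ᶠ[nhds y] fun t => D (x, t) (0, 1) := by
        filter_upwards [isOpen_Ioo.mem_nhds hp] with t ht
        exact ((hdy x t (Ioo_subset_Icc_self ht)).hasDerivAt (Icc_mem_nhds ht.1 ht.2)).deriv
      rw [pd2, this.deriv_eq]
      have h := hDf.comp_hasDerivAt (f := fun t : ℝ => (x, t)) y
        ((hasDerivAt_const y x).prodMk (hasDerivAt_id y))
      have h' := h.clm_apply (hasDerivAt_const y ((0 : ℝ), (1 : ℝ)))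
      simpa using h'.deriv
    simp only [lap, e1, e2]
  have hmeas : MeasurableSet (Omega0 L) := measurableSet_Ioo.prod measurableSet_Ioo
  have hlapI : IntegrableOn (fun p : ℝ × ℝ => (lap v p.1 p.2) ^ 2) (Omega0 L) := by
    have hsub : Icc ((0 : ℝ), (0 : ℝ)) (L, 1) ⊆ S := fun p hp => ⟨trivial, hp.1.2, hp.2.2⟩
    have hc : ContinuousOn (fun p => (DD p (1, 0) (1, 0) + DD p (0, 1) (0, 1)) ^ 2) S :=
      ((((hDDc.clm_apply continuousOn_const).clm_apply continuousOn_const)).add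
        ((hDDc.clm_apply continuousOn_const).clm_apply continuousOn_const)).pow 2
    have hi : IntegrableOn (fun p => (DD p (1, 0) (1, 0) + DD p (0, 1) (0, 1)) ^ 2) (Omega0 L) :=
      ((hc.mono hsub).integrableOn_compact isCompact_Icc).mono_set (fun p hp =>
        ⟨⟨hp.1.1.le, hp.2.1.le⟩, ⟨hp.1.2.le, hp.2.2.le⟩⟩)
    refine hi.congr_fun (fun p hp => ?_) hmeas
    simp only [hlap p hp.2]
  have key : ∀ p ∈ Omega0 L,
      -(fderivWithin ℝ P S p (1, 0) + fderivWithin ℝ Q S p (0, 1)) ≤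
        5 * (lap v p.1 p.2) ^ 2 := by
    intro p hp
    have hy : p.2 ∈ Icc (0 : ℝ) 1 := Ioo_subset_Icc_self hp.2
    have hpS : p ∈ S := ⟨trivial, hy⟩
    have hn := S_nhds hp.2
    have hDf : HasFDerivAt D (DD p) p :=
      (hDc.differentiableOn one_ne_zero p hpS).hasFDerivWithinAt.hasFDerivAt hn
    have hsym : DD p (1, 0) (0, 1) = DD p (0, 1) (1, 0) := by
      have hs : ContDiffWithinAt ℝ 2 u S p := hv p hpS
      have := (hs.isSymmSndFDerivWithinAt (by simp) uds
        (subset_closure (mem_interior_iff_mem_nhds.2 hn)) hpS)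
      exact this _ _
    have hUf : HasFDerivAt u (D p) p := (hdu p hpS).hasFDerivAt hn
    have hAf := hDf.clm_apply (hasFDerivAt_const ((1 : ℝ), (0 : ℝ)) p)
    have hBf := hDf.clm_apply (hasFDerivAt_const ((0 : ℝ), (1 : ℝ)) p)
    have hY : HasFDerivAt (fun p : ℝ × ℝ => p.2) (ContinuousLinearMap.snd ℝ ℝ ℝ) p :=
      hasFDerivAt_snd
    change HasFDerivAt a _ p at hAf
    change HasFDerivAt b _ p at hBf
    have hPf := ((((hY.const_sub 1).const_mul 2).mul hAf).mul hBf).add ((hUf.const_mul 4).mul hAf)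
    have hQf := (((hY.const_sub 1).mul ((hBf.pow 2).sub (hAf.pow 2))).add
      ((hUf.const_mul 4).mul hBf)).add (((hY.const_mul 2).sub_const 1).mul (hUf.pow 2))
    have hPe := hPf.hasFDerivWithinAt.fderivWithin (uds p hpS)
    have hQe := hQf.hasFDerivWithinAt.fderivWithin (uds p hpS)
    change fderivWithin ℝ P S p = _ at hPe
    change fderivWithin ℝ Q S p = _ at hQe
    have := pw (1 - p.2) (2 * p.2 - 1) (a p) (b p) (u p) (lap v p.1 p.2)
      (by nlinarith [hy.1, hy.2]) (by nlinarith [hy.1, hy.2])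
    refine le_trans (le_of_eq ?_) this
    rw [hPe, hQe, hlap p hp.2]
    have a1 : D p (1, 0) = a p := rfl
    have b1 : D p (0, 1) = b p := rfl
    simp [a1, b1, hsym]
    ring
  have hfin := setIntegral_mono_on hI.neg (hlapI.const_mul 5) hmeas key
  simp only [Pi.neg_apply] at hfin
  rw [integral_const_mul] at hfin
  have h3 : ∫ p in Omega0 L, -(fderivWithin ℝ P S p (1, 0) + fderivWithin ℝ Q S p (0, 1))
      = ∫ t in (0 : ℝ)..L, (normalDerivStrip v t) ^ 2 := by
    rw [integral_neg, hE, hbd, neg_neg]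
  rw [← h3]
  exact hfin

end NDE

/-- Normal-derivative elliptic estimate used in the very weak (duality) argument:
for `v` of class `C²` on the closed strip, `L`-periodic in `x₁` and vanishing on both
horizontal boundaries, `∫₀^L |∂v/∂x₂(x₁,0)|² dx₁ ≤ c ∫_{Ω⁰} |Δv|² dx` with `c = c(L)`. -/
theorem normal_derivative_duality_estimate (L : ℝ) (hL : 0 < L) :
    ∃ c > (0 : ℝ), ∀ v : ℝ → ℝ → ℝ,
      ContDiffOn ℝ 2 (fun p : ℝ × ℝ => v p.1 p.2) ((univ : Set ℝ) ×ˢ Icc (0 : ℝ) 1) →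
      (∀ x y, v (x + L) y = v x y) →
      (∀ x, v x 0 = 0) → (∀ x, v x 1 = 0) →
      (∫ t in (0 : ℝ)..L, (normalDerivStrip v t) ^ 2)
        ≤ c * ∫ p in Omega0 L, (lap v p.1 p.2) ^ 2 := by
  exact ⟨5, by norm_num, fun v hv hp h0 h1 => NDE.main L hL v hv hp h0 h1⟩

end
end
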